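/- Let X be a non-linear carpet satisfying the coordinate open set condition. Then dim_H X = sup{dim_H μ : μ an ergodic measure on X}; that is, dim_H μ ≤ dim_H X for every ergodic measure μ on X, and for every ε > 0 there exists an ergodic measure μ on X with dim_H μ ≥ dim_H X − ε. -/

import Mathlib

open Set Filter MeasureTheory Metric
open scoped ENNReal NNReal

noncomputable section

/-- Composition of the maps of an IFS along a finite word (in order). -/
def compWord {Λ : Type*} (f : Λ → ℝ → ℝ) : List Λ → ℝ → ℝ
  | [] => id
  | i :: w => f i ∘ compWord f w

/-- The chain-rule derivative of `compWord f w`, expressed via the derivatives `f'`. -/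
def wordDeriv {Λ : Type*} (f f' : Λ → ℝ → ℝ) : List Λ → ℝ → ℝ
  | [] => fun _ => 1
  | i :: w => fun x => f' i (compWord f w x) * wordDeriv f f' w x

/-- `‖f_w'‖`: the sup over `[0,1]` of `|f_w'|`. -/
def wordDerivNorm {Λ : Type*} (f f' : Λ → ℝ → ℝ) (w : List Λ) : ℝ :=
  sSup ((fun x => |wordDeriv f f' w x|) '' Icc (0:ℝ) 1)

/-- A self-conformal IFS on `[0,1]`: finitely many uniformly contracting differentiable maps
with Hölder continuous non-vanishing derivatives. -/
structure ConformalIFS (Λ : Type*) where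
  f : Λ → ℝ → ℝ
  f' : Λ → ℝ → ℝ
  mapsTo : ∀ i, MapsTo (f i) (Icc (0:ℝ) 1) (Icc (0:ℝ) 1)
  hasDeriv : ∀ i, ∀ x ∈ Icc (0:ℝ) 1, HasDerivWithinAt (f i) (f' i x) (Icc (0:ℝ) 1) x
  exponent : ℝ
  exponent_pos : 0 < exponent
  holder : ∀ i, ∃ C : ℝ, ∀ x ∈ Icc (0:ℝ) 1, ∀ y ∈ Icc (0:ℝ) 1,
    |f' i x - f' i y| ≤ C * |x - y| ^ exponent
  nonvanishing : ∀ i, ∀ x ∈ Icc (0:ℝ) 1, f' i x ≠ 0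
  ratio : ℝ
  ratio_pos : 0 < ratio
  ratio_lt_one : ratio < 1
  contracting : ∀ i, ∀ x ∈ Icc (0:ℝ) 1, ∀ y ∈ Icc (0:ℝ) 1, |f i x - f i y| ≤ ratio * |x - y|

/-- The open set condition (with an open subset of `[0,1]`) for a conformal IFS. -/
def CoordOSC {Λ : Type*} (F : ConformalIFS Λ) : Prop :=
  ∃ U : Set ℝ, U.Nonempty ∧ U ⊆ Icc 0 1 ∧ (∃ O : Set ℝ, IsOpen O ∧ U = O ∩ Icc 0 1) ∧
    (∀ i, F.f i '' U ⊆ U) ∧ Pairwise fun i i' => Disjoint (F.f i '' U) (F.f i' '' U)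

end
noncomputable section

/-- The planar map `S_{(i,j)}(x,y) = (f_i(x), g_j(y))`. -/
def carpetMap {Λ₁ Λ₂ : Type*} (F : ConformalIFS Λ₁) (G : ConformalIFS Λ₂)
    (ij : Λ₁ × Λ₂) (p : ℝ × ℝ) : ℝ × ℝ :=
  (F.f ij.1 p.1, G.f ij.2 p.2)

/-- `X` is the attractor (a non-linear carpet) of the IFS `(S_{(i,j)})_{(i,j) ∈ A}`. -/
def IsCarpetAttractor {Λ₁ Λ₂ : Type*} (F : ConformalIFS Λ₁) (G : ConformalIFS Λ₂)
    (A : Set (Λ₁ × Λ₂)) (X : Set (ℝ × ℝ)) : Prop :=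
  X.Nonempty ∧ IsCompact X ∧ X ⊆ Icc (0:ℝ) 1 ×ˢ Icc (0:ℝ) 1 ∧
    X = ⋃ ij ∈ A, carpetMap F G ij '' X

/-- The natural projection `π : Λ^ℕ → X`, `π(ω) = lim_n S_{ω₀} ∘ ⋯ ∘ S_{ω_{n-1}} (0,0)`. -/
noncomputable def natProj {Λ₁ Λ₂ : Type*} (F : ConformalIFS Λ₁) (G : ConformalIFS Λ₂)
    (ω : ℕ → Λ₁ × Λ₂) : ℝ × ℝ :=
  limUnder Filter.atTop fun n =>
    (((List.range n).map ω).foldr (fun ij h => carpetMap F G ij ∘ h) id) (0, 0)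

/-- Hausdorff dimension of a measure: the infimum of Hausdorff dimensions of Borel sets of full
measure. -/
noncomputable def dimHMeasure {E : Type*} [EMetricSpace E] [MeasurableSpace E]
    (μ : MeasureTheory.Measure E) : ℝ≥0∞ :=
  sInf {s | ∃ A : Set E, MeasurableSet A ∧ μ A = 1 ∧ dimH A = s}

/-- `μ` is an ergodic measure on the carpet: the pushforward under the natural projection of a
shift-invariant ergodic probability measure on `Λ^ℕ` (where `Λ = A`). -/
def IsErgodicCarpetMeasure {Λ₁ Λ₂ : Type*} (F : ConformalIFS Λ₁) (G : ConformalIFS Λ₂)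
    (A : Set (Λ₁ × Λ₂)) (μ : MeasureTheory.Measure (ℝ × ℝ)) : Prop :=
  letI : MeasurableSpace (↥A) := ⊤
  ∃ ν : MeasureTheory.Measure (ℕ → ↥A), MeasureTheory.IsProbabilityMeasure ν ∧
    Ergodic (fun ω k => ω (k + 1)) ν ∧
    μ = ν.map fun ω => natProj F G fun k => ((ω k : Λ₁ × Λ₂))

/-- Letter-count vector of a finite word. -/
def cpTyp {B : Type*} [DecidableEq B] {m : ℕ} (u : Fin m → B) : B → ℕ :=
  fun b => ∑ i, if u i = b then 1 else 0

/-- Number of words having the same letter counts as `u`. -/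
def cpTc {B : Type*} [DecidableEq B] [Fintype B] {m : ℕ} (u : Fin m → B) : ℕ :=
  (Finset.univ.filter (fun w : Fin m → B => cpTyp w = cpTyp u)).card

theorem cpTc_pos {B : Type*} [DecidableEq B] [Fintype B] {m : ℕ} (u : Fin m → B) :
    0 < cpTc u :=
  Finset.card_pos.2 ⟨u, by simp⟩

theorem cpTc_congr {B : Type*} [DecidableEq B] [Fintype B] {m : ℕ} {u v : Fin m → B}
    (h : cpTyp u = cpTyp v) : cpTc u = cpTc v := by
  unfold cpTc; rw [h]

theorem cpTc_le {B : Type*} [DecidableEq B] [Fintype B] {m : ℕ} (u : Fin m → B) :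
    cpTc u ≤ Fintype.card B ^ m := by
  refine (Finset.card_le_univ _).trans ?_
  simp

theorem cpTyp_perm {B : Type*} [DecidableEq B] {m : ℕ} (u : Fin m → B)
    (σ : Equiv.Perm (Fin m)) : cpTyp (u ∘ σ) = cpTyp u := by
  funext b
  exact Equiv.sum_comp σ (fun i => if u i = b then 1 else 0)

theorem cpTyp_exists_perm {B : Type*} [DecidableEq B] {m : ℕ} {u w : Fin m → B}
    (h : cpTyp w = cpTyp u) : ∃ σ : Equiv.Perm (Fin m), w = u ∘ σ := by
  have hc : ∀ b, Nonempty ({i // w i = b} ≃ {i // u i = b}) := by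
    intro b
    have := congrFun h b
    simp only [cpTyp, Finset.sum_boole, Nat.cast_id] at this
    refine ⟨Fintype.equivOfCardEq ?_⟩
    rw [Fintype.card_subtype, Fintype.card_subtype, this]
  have e := fun b => Classical.choice (hc b)
  refine ⟨(Equiv.sigmaFiberEquiv w).symm.trans
    ((Equiv.sigmaCongrRight e).trans (Equiv.sigmaFiberEquiv u)), ?_⟩
  funext i
  have := (e (w i) ⟨i, rfl⟩).2
  exact this.symm

theorem cpTyp_add {B : Type*} [DecidableEq B] {m k : ℕ} (u : Fin m → B) (v : Fin k → B) :
    cpTyp (Fin.append u v) = cpTyp u + cpTyp v := by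
  funext b
  simp only [cpTyp, Fin.sum_univ_add, Fin.append_left, Fin.append_right, Pi.add_apply]

theorem cpTc_append {B : Type*} [DecidableEq B] [Fintype B] {m k : ℕ} (u : Fin m → B)
    (v : Fin k → B) : cpTc u * cpTc v ≤ cpTc (Fin.append u v) := by
  unfold cpTc
  rw [← Finset.card_product]
  refine Finset.card_le_card_of_injOn (fun z => Fin.append z.1 z.2) ?_ ?_
  · rintro ⟨a, b⟩ h
    simp only [Finset.coe_product, Finset.coe_filter, Finset.mem_univ, true_and, Set.mem_prod,
      Set.mem_ofPred_eq] at h ⊢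
    rw [cpTyp_add, cpTyp_add, h.1, h.2]
  · rintro ⟨a, b⟩ _ ⟨a', b'⟩ _ h
    simp only at h
    have h1 : a = a' := by
      funext i
      have := congrFun h (Fin.castAdd k i)
      simpa using this
    have h2 : b = b' := by
      funext i
      have := congrFun h (Fin.natAdd m i)
      simpa using this
    rw [h1, h2]

theorem cpTc_initial {B : Type*} [DecidableEq B] [Fintype B] (x : ℕ → B) (m k : ℕ) :
    cpTc (fun i : Fin m => x i) * cpTc (fun i : Fin k => x (m + i)) ≤
      cpTc (fun i : Fin (m + k) => x i) := by
  refine (cpTc_append _ _).trans (le_of_eq ?_)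
  congr 1
  funext i
  refine Fin.addCases (fun i => ?_) (fun i => ?_) i <;> simp

theorem cpTyp_comp {B J : Type*} [DecidableEq B] [DecidableEq J] {m : ℕ} (q : B → J)
    {u w : Fin m → B} (h : cpTyp w = cpTyp u) : cpTyp (q ∘ w) = cpTyp (q ∘ u) := by
  obtain ⟨σ, rfl⟩ := cpTyp_exists_perm h
  rw [← Function.comp_assoc, cpTyp_perm]

theorem cpTc_fiber {B J : Type*} [DecidableEq B] [Fintype B] [DecidableEq J] [Fintype J]
    {m : ℕ} (q : B → J) (u : Fin m → B) (v : Fin m → J) (hv : cpTyp v = cpTyp (q ∘ u)) :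
    (Finset.univ.filter (fun w : Fin m → B => cpTyp w = cpTyp u ∧ q ∘ w = v)).card
      * cpTc (q ∘ u) = cpTc u := by
  have key : ∀ v' : Fin m → J, cpTyp v' = cpTyp (q ∘ u) →
      (Finset.univ.filter (fun w : Fin m → B => cpTyp w = cpTyp u ∧ q ∘ w = v')).card =
      (Finset.univ.filter (fun w : Fin m → B => cpTyp w = cpTyp u ∧ q ∘ w = v)).card := by
    intro v' hv'
    obtain ⟨σ, rfl⟩ := cpTyp_exists_perm (hv'.trans hv.symm)
    symm
    refine Finset.card_bij (fun w _ => w ∘ σ) ?_ ?_ ?_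
    · intro w hw
      simp only [Finset.mem_filter, Finset.mem_univ, true_and] at hw ⊢
      exact ⟨by rw [cpTyp_perm, hw.1], by rw [← hw.2]; rfl⟩
    · intro w _ w' _ h
      exact σ.surjective.injective_comp_right h
    · intro w hw
      simp only [Finset.mem_filter, Finset.mem_univ, true_and] at hw
      refine ⟨w ∘ σ.symm, ?_, ?_⟩
      · simp only [Finset.mem_filter, Finset.mem_univ, true_and]
        refine ⟨by rw [cpTyp_perm, hw.1], ?_⟩
        rw [← Function.comp_assoc, hw.2]
        funext i; simp
      · funext i; simp
  have h1 : cpTc u = ∑ v' ∈ Finset.univ.filter (fun v' : Fin m → J => cpTyp v' = cpTyp (q ∘ u)),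
      (Finset.univ.filter (fun w : Fin m → B => cpTyp w = cpTyp u ∧ q ∘ w = v')).card := by
    unfold cpTc
    rw [Finset.card_eq_sum_card_fiberwise (f := fun w => q ∘ w)
      (t := Finset.univ.filter (fun v' : Fin m → J => cpTyp v' = cpTyp (q ∘ u)))]
    · refine Finset.sum_congr rfl fun v' _ => ?_
      rw [Finset.filter_filter]
    · intro w hw
      simp only [Finset.coe_filter, Finset.mem_univ, true_and, Set.mem_ofPred_eq] at hw ⊢
      exact cpTyp_comp q hw
  rw [h1, Finset.sum_congr rfl (fun v' hv' => key v' (by simpa using hv'))]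
  simp [cpTc, mul_comm]

theorem cpTc_sum_le {B : Type*} [DecidableEq B] [Fintype B] (m : ℕ) :
    ∑ u : Fin m → B, (1 / (cpTc u : ℝ)) ≤ ((m : ℝ) + 1) ^ Fintype.card B := by
  set T : Finset (B → ℕ) := Fintype.piFinset (fun _ => Finset.range (m + 1)) with hT
  have hmaps : ∀ u ∈ (Finset.univ : Finset (Fin m → B)), cpTyp u ∈ T := by
    intro u _
    rw [hT, Fintype.mem_piFinset]
    intro b
    rw [Finset.mem_range, Nat.lt_succ_iff]
    simp only [cpTyp, Finset.sum_boole, Nat.cast_id]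
    refine (Finset.card_le_univ _).trans ?_
    simp
  rw [← Finset.sum_fiberwise_of_maps_to hmaps]
  have : ∀ t ∈ T, ∑ u ∈ Finset.univ.filter (fun u : Fin m → B => cpTyp u = t),
      (1 / (cpTc u : ℝ)) ≤ 1 := by
    intro t _
    by_cases h : ∃ u0 : Fin m → B, cpTyp u0 = t
    · obtain ⟨u0, rfl⟩ := h
      have : ∀ u ∈ Finset.univ.filter (fun u : Fin m → B => cpTyp u = cpTyp u0),
          (1 / (cpTc u : ℝ)) = 1 / (cpTc u0 : ℝ) := by
        intro u hu
        rw [cpTc_congr (by simpa using hu)]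
      rw [Finset.sum_congr rfl this, Finset.sum_const, nsmul_eq_mul]
      have h0 : (cpTc u0 : ℝ) ≠ 0 := by exact_mod_cast (cpTc_pos u0).ne'
      change (cpTc u0 : ℝ) * _ ≤ 1
      rw [mul_one_div_cancel h0]
    · rw [Finset.sum_eq_zero]
      · norm_num
      · intro u hu
        exact absurd ⟨u, by simpa using hu⟩ h
  refine (Finset.sum_le_sum this).trans ?_
  simp [hT]

theorem cp_zsum (B : Type*) [DecidableEq B] [Fintype B] {c : ℝ} (hc : 0 < c) :
    ∑' s : (Σ m : ℕ, (Fin m → B)), ENNReal.ofReal (Real.exp (-c * s.1) / cpTc s.2) ≠ ∞ := by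
  rw [ENNReal.tsum_sigma']
  have hb : ∀ m : ℕ, ∑' u : Fin m → B, ENNReal.ofReal (Real.exp (-c * m) / cpTc u) ≤
      ENNReal.ofReal (((m : ℝ) + 1) ^ Fintype.card B * Real.exp (-c * m)) := by
    intro m
    rw [tsum_fintype, ← ENNReal.ofReal_sum_of_nonneg (fun _ _ => by positivity)]
    refine ENNReal.ofReal_le_ofReal ?_
    have := mul_le_mul_of_nonneg_left (cpTc_sum_le (B := B) m) (Real.exp_pos (-c * m)).le
    rw [Finset.mul_sum] at this
    rw [mul_comm (_ ^ _)]
    refine le_trans (le_of_eq ?_) this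
    refine Finset.sum_congr rfl fun u _ => by ring
  refine ne_top_of_le_ne_top ?_ (ENNReal.tsum_le_tsum hb)
  have hs : Summable fun m : ℕ => ((m : ℝ) + 1) ^ Fintype.card B * Real.exp (-c * m) := by
    have h1 := (summable_nat_add_iff 1).2 (Real.summable_pow_mul_exp_neg_nat_mul
      (Fintype.card B) hc)
    refine (h1.mul_left (Real.exp c)).congr fun m => ?_
    push_cast
    rw [mul_left_comm, ← Real.exp_add]
    congr 2
    ring
  rw [← ENNReal.ofReal_tsum_of_nonneg (fun _ => by positivity) hs]
  exact ENNReal.ofReal_ne_top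


theorem cp_tsum_prod {α β : Type*} (f : α → ℝ≥0∞) (g : β → ℝ≥0∞) :
    ∑' z : α × β, f z.1 * g z.2 = (∑' x, f x) * ∑' y, g y := by
  refine (ENNReal.tsum_prod (f := fun a b => f a * g b)).trans ?_
  simp only [ENNReal.tsum_mul_left, ENNReal.tsum_mul_right]

theorem cp_good {B I J : Type*} [Fintype B] [DecidableEq B] [Fintype J] [DecidableEq J]
    (p : B → I) (q : B → J) (a : I → ℝ) (b : J → ℝ) (θ bM : ℝ) (hθ : 0 < θ)
    (ha : ∀ i, θ ≤ a i) (hb : ∀ j, θ ≤ b j) (hbM : ∀ j, b j ≤ bM) (d : ℝ)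
    (hD : ∀ (m : ℕ) (u : Fin m → B), 0 < m → ∑ i, b (q (u i)) ≤ ∑ i, a (p (u i)) →
      (Real.log (cpTc u) - Real.log (cpTc (q ∘ u))) / (∑ i, a (p (u i))) +
        Real.log (cpTc (q ∘ u)) / (∑ i, b (q (u i))) ≤ d)
    (ε : ℝ) (hε : 0 < ε) (ω : ℕ → B)
    (hω : ∀ n, ∃ m ≥ n, ∑ i : Fin m, b (q (ω i)) ≤ ∑ i : Fin m, a (p (ω i))) (n : ℕ) :
    ∃ m ≥ n, ∃ k : ℕ,
      ∑ i : Fin m, b (q (ω i)) + ∑ i : Fin k, b (q (ω (m + i))) ≤ ∑ i : Fin m, a (p (ω i)) ∧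
      ∑ i : Fin m, a (p (ω i)) ≤
        ∑ i : Fin m, b (q (ω i)) + ∑ i : Fin k, b (q (ω (m + i))) + bM ∧
      Real.log (cpTc fun i : Fin m => ω i) + Real.log (cpTc fun i : Fin k => q (ω (m + i)))
        ≤ (∑ i : Fin m, a (p (ω i))) * (d + ε) := by
  set S1 : ℕ → ℝ := fun m => ∑ i : Fin m, a (p (ω i)) with hS1
  set S2 : ℕ → ℝ := fun m => ∑ i : Fin m, b (q (ω i)) with hS2
  have hS2add : ∀ m k, S2 m + ∑ i : Fin k, b (q (ω (m + i))) = S2 (m + k) := by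
    intro m k
    simp only [hS2, Fin.sum_univ_add]
    simp
  have hS1add : ∀ m k, S1 m + ∑ i : Fin k, a (p (ω (m + i))) = S1 (m + k) := by
    intro m k
    simp only [hS1, Fin.sum_univ_add]
    simp
  have hS1mono : ∀ m k, S1 m ≤ S1 (m + k) := by
    intro m k
    rw [← hS1add]
    have : 0 ≤ ∑ i : Fin k, a (p (ω (m + i))) :=
      Finset.sum_nonneg fun i _ => hθ.le.trans (ha _)
    linarith
  have hS2low : ∀ m : ℕ, m * θ ≤ S2 m := by
    intro m
    have := Finset.card_nsmul_le_sum (Finset.univ : Finset (Fin m)) (fun i => b (q (ω i))) θ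
      (fun i _ => hb _)
    simpa using this
  have hS2succ : ∀ m, S2 (m + 1) ≤ S2 m + bM := by
    intro m
    rw [← hS2add]
    simpa using hbM _
  set φ : ℕ → ℝ := fun m => Real.log (cpTc (fun i : Fin m => q (ω i))) / S2 m with hφ
  have hlog : ∀ {m : ℕ} (u : Fin m → J), 0 ≤ Real.log (cpTc u) := fun u =>
    Real.log_natCast_nonneg _
  have hS2pos : ∀ m, 0 < m → 0 < S2 m := fun m hm =>
    lt_of_lt_of_le (by positivity) (hS2low m)
  have hφ0 : ∀ m, 0 < m → 0 ≤ φ m := fun m hm => div_nonneg (hlog _) (hS2pos m hm).le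
  have hφC : ∀ m, 0 < m → φ m ≤ Real.log (Fintype.card J) / θ := by
    intro m hm
    have hm' : (0 : ℝ) < m := by exact_mod_cast hm
    have h1 : Real.log (cpTc (fun i : Fin m => q (ω i))) ≤ m * Real.log (Fintype.card J) := by
      rw [← Real.log_pow]
      refine Real.log_le_log (by exact_mod_cast cpTc_pos _) ?_
      exact_mod_cast cpTc_le _
    have h0 : 0 ≤ Real.log (Fintype.card J) := Real.log_natCast_nonneg _
    simp only [hφ]
    rw [div_le_div_iff₀ (hS2pos m hm) hθ]
    calc _ ≤ m * Real.log (Fintype.card J) * θ := by gcongr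
      _ = Real.log (Fintype.card J) * (m * θ) := by ring
      _ ≤ _ := by gcongr; exact hS2low m
  have hnext : ∀ m, S2 m ≤ S1 m → ∃ k, S2 (m + k) ≤ S1 m ∧ S1 m ≤ S2 (m + k) + bM := by
    intro m hm
    have hex : ∃ k, S1 m < S2 (m + k) := by
      obtain ⟨k, hk⟩ := exists_nat_gt (S1 m / θ)
      refine ⟨k, ?_⟩
      have h1 := hS2low (m + k)
      rw [div_lt_iff₀ hθ] at hk
      push_cast at h1
      have : 0 ≤ (m : ℝ) * θ := by positivity
      linarith
    classical
    have hk := Nat.find_spec hex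
    have hmin := fun j => Nat.find_min hex (m := j)
    rcases h : Nat.find hex with _ | k
    · rw [h] at hk
      simp only [add_zero] at hk
      linarith
    · rw [h] at hk
      refine ⟨k, not_lt.1 (hmin k (by rw [h]; exact Nat.lt_succ_self k)), ?_⟩
      exact hk.le.trans (hS2succ _)
  by_contra hcon
  push Not at hcon
  have hstep : ∀ m ≥ n, 0 < m → S2 m ≤ S1 m → ∃ k, S2 (m + k) ≤ S1 (m + k) ∧
      φ m + ε ≤ φ (m + k) := by
    intro m hmn hm0 hm
    obtain ⟨k, hk1, hk2⟩ := hnext m hm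
    refine ⟨k, hk1.trans (hS1mono m k), ?_⟩
    by_contra hlt
    push Not at hlt
    have hc := hcon m hmn k (by rw [← hS2add] at hk1; exact hk1) (by rw [← hS2add] at hk2; exact hk2)
    refine absurd hc (not_lt.2 ?_)
    have hsup := cpTc_initial (fun i => q (ω i)) m k
    have hsup' : Real.log (cpTc (fun i : Fin m => q (ω i))) +
        Real.log (cpTc (fun i : Fin k => q (ω (m + i)))) ≤
        Real.log (cpTc (fun i : Fin (m + k) => q (ω i))) := by
      rw [← Real.log_mul (by exact_mod_cast (cpTc_pos _).ne')
        (by exact_mod_cast (cpTc_pos _).ne')]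
      refine Real.log_le_log ?_ (by exact_mod_cast hsup)
      have h1 := cpTc_pos (fun i : Fin m => q (ω i))
      have h2 := cpTc_pos (fun i : Fin k => q (ω (m + i)))
      positivity
    have hd := hD m (fun i => ω i) hm0 hm
    have e1 : Real.log (cpTc (q ∘ fun i : Fin m => ω i)) / S2 m = φ m := rfl
    change _ / S1 m + Real.log (cpTc (q ∘ fun i : Fin m => ω i)) / S2 m ≤ d at hd
    rw [e1] at hd
    have hS1pos : 0 < S1 m := (hS2pos m hm0).trans_le hm
    have e2 : Real.log (cpTc (fun i : Fin (m + k) => q (ω i))) = φ (m + k) * S2 (m + k) := by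
      simp only [hφ]
      rw [div_mul_cancel₀ _ (hS2pos _ (by omega)).ne']
    have h3 : φ (m + k) * S2 (m + k) ≤ φ (m + k) * S1 m :=
      mul_le_mul_of_nonneg_left hk1 (hφ0 _ (by omega))
    have h4 : Real.log (cpTc fun i : Fin m => ω i) -
        Real.log (cpTc (q ∘ fun i : Fin m => ω i)) ≤ (d - φ m) * S1 m := by
      rw [← div_le_iff₀ hS1pos]; linarith
    have h5 : (q ∘ fun i : Fin m => ω i) = fun i : Fin m => q (ω i) := rfl
    rw [h5] at h4
    have h6 : φ (m + k) * S1 m ≤ (φ m + ε) * S1 m :=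
      mul_le_mul_of_nonneg_right hlt.le hS1pos.le
    change _ ≤ S1 m * (d + ε)
    nlinarith
  have hiter : ∀ j : ℕ, ∃ m ≥ n, 0 < m ∧ S2 m ≤ S1 m ∧ (j : ℝ) * ε ≤ φ m := by
    intro j
    induction j with
    | zero =>
      obtain ⟨m, hm, h⟩ := hω (n + 1)
      exact ⟨m, by omega, by omega, h, by simpa using hφ0 m (by omega)⟩
    | succ j ih =>
      obtain ⟨m, hm, hm0, h, hj⟩ := ih
      obtain ⟨k, hk, hk2⟩ := hstep m hm hm0 h
      refine ⟨m + k, by omega, by omega, hk, ?_⟩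
      push_cast
      linarith
  obtain ⟨j, hj⟩ := exists_nat_gt (Real.log (Fintype.card J) / θ / ε)
  obtain ⟨m, _, hm0, _, hm⟩ := hiter j
  rw [div_lt_iff₀ hε] at hj
  have := hφC m hm0
  linarith

/-- The covering argument in the regime where the first coordinate contracts faster infinitely
often. -/
theorem cp_cover {B I J : Type*} [Fintype B] [DecidableEq B] [Fintype J] [DecidableEq J]
    (p : B → I) (q : B → J) (a : I → ℝ) (b : J → ℝ) (θ bM : ℝ) (hθ : 0 < θ)
    (ha : ∀ i, θ ≤ a i) (hb : ∀ j, θ ≤ b j) (hbM : ∀ j, b j ≤ bM) (hbM0 : 0 ≤ bM)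
    (Φ : (ℕ → I) → ℝ) (Ψ : (ℕ → J) → ℝ)
    (hΦ : ∀ (n : ℕ) (ω ω' : ℕ → I), (∀ k < n, ω k = ω' k) →
      |Φ ω - Φ ω'| ≤ Real.exp (-∑ i : Fin n, a (ω i)))
    (hΨ : ∀ (n : ℕ) (ω ω' : ℕ → J), (∀ k < n, ω k = ω' k) →
      |Ψ ω - Ψ ω'| ≤ Real.exp (-∑ i : Fin n, b (ω i)))
    (d : ℝ) (hd : 0 ≤ d)
    (hD : ∀ (m : ℕ) (u : Fin m → B), 0 < m → ∑ i, b (q (u i)) ≤ ∑ i, a (p (u i)) →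
      (Real.log (cpTc u) - Real.log (cpTc (q ∘ u))) / (∑ i, a (p (u i))) +
        Real.log (cpTc (q ∘ u)) / (∑ i, b (q (u i))) ≤ d)
    (G : Set (ℕ → B))
    (hG : ∀ ω ∈ G, ∀ n, ∃ m ≥ n, ∑ i : Fin m, b (q (ω i)) ≤ ∑ i : Fin m, a (p (ω i))) :
    dimH ((fun ω => (Φ (p ∘ ω), Ψ (q ∘ ω))) '' G) ≤ ENNReal.ofReal d := by
  have main : ∀ ε : ℝ, 0 < ε → dimH ((fun ω => (Φ (p ∘ ω), Ψ (q ∘ ω))) '' G) ≤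
      ENNReal.ofReal (d + 2 * ε) := by
    intro ε hε
    set s : ℝ := d + 2 * ε with hs
    have hs0 : 0 < s := by positivity
    refine dimH_le_of_hausdorffMeasure_ne_top (d := Real.toNNReal s) ?_
    rw [Real.coe_toNNReal s hs0.le]
    set Good : ∀ m k : ℕ, (Fin m → B) → (Fin k → J) → Prop := fun m k u v =>
      ∑ i, b (q (u i)) + ∑ i, b (v i) ≤ ∑ i, a (p (u i)) ∧
      ∑ i, a (p (u i)) ≤ ∑ i, b (q (u i)) + ∑ i, b (v i) + bM ∧
      Real.log (cpTc u) + Real.log (cpTc v) ≤ (∑ i, a (p (u i))) * (d + ε) with hGood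
    set t : ℕ → ((Σ m : ℕ, (Fin m → B)) × (Σ k : ℕ, (Fin k → J))) → Set (ℝ × ℝ) :=
      fun n z => {x | n ≤ z.1.1 ∧ Good z.1.1 z.2.1 z.1.2 z.2.2 ∧ ∃ ω : ℕ → B,
        (∀ i, ω (i : Fin z.1.1) = z.1.2 i) ∧ (∀ i : Fin z.2.1, q (ω (z.1.1 + i)) = z.2.2 i) ∧
        x = (Φ (p ∘ ω), Ψ (q ∘ ω))} with ht
    have hdiam : ∀ n z, ediam (t n z) ≤
        ENNReal.ofReal (Real.exp bM * Real.exp (-∑ i, a (p (z.1.2 i)))) := by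
      rintro n ⟨⟨m, u⟩, ⟨k, v⟩⟩
      refine ediam_le ?_
      rintro x ⟨_, hgood, ω, h1, h2, rfl⟩ y ⟨_, _, ω', h1', h2', rfl⟩
      simp only at h1 h2 h1' h2' hgood ⊢
      rw [edist_dist]
      refine ENNReal.ofReal_le_ofReal ?_
      rw [Prod.dist_eq, max_le_iff]
      simp only [Real.dist_eq]
      have hpos := Real.exp_pos (-∑ i, a (p (u i)))
      constructor
      · refine (hΦ m _ _ ?_).trans ?_
        · intro j hj
          have e1 := h1 ⟨j, hj⟩
          have e2 := h1' ⟨j, hj⟩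
          simp only at e1 e2
          simp [e1, e2]
        · have : ∑ i : Fin m, a ((p ∘ ω) i) = ∑ i, a (p (u i)) := by
            simp [h1]
          rw [this]
          have : 1 ≤ Real.exp bM := Real.one_le_exp hbM0
          nlinarith
      · refine (hΨ (m + k) _ _ ?_).trans ?_
        · intro j hj
          by_cases hjm : j < m
          · have e1 := h1 ⟨j, hjm⟩
            have e2 := h1' ⟨j, hjm⟩
            simp only at e1 e2
            simp [e1, e2]
          · have e1 := h2 ⟨j - m, by omega⟩
            have e2 := h2' ⟨j - m, by omega⟩
            simp only [show m + (j - m) = j by omega] at e1 e2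
            simp [e1, e2]
        · have : ∑ i : Fin (m + k), b ((q ∘ ω) i) = ∑ i, b (q (u i)) + ∑ i, b (v i) := by
            rw [Fin.sum_univ_add]
            simp [h1, h2]
          rw [this, ← Real.exp_add]
          refine Real.exp_le_exp.2 ?_
          have := hgood.2.1
          linarith
    have hSlow : ∀ (m : ℕ) (u : Fin m → B), m * θ ≤ ∑ i, a (p (u i)) := by
      intro m u
      have := Finset.card_nsmul_le_sum (Finset.univ : Finset (Fin m)) (fun i => a (p (u i))) θ
        (fun i _ => ha _)
      simpa using this
    have hSlow2 : ∀ (m : ℕ) (u : Fin m → J), m * θ ≤ ∑ i, b (u i) := by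
      intro m u
      have := Finset.card_nsmul_le_sum (Finset.univ : Finset (Fin m)) (fun i => b (u i)) θ
        (fun i _ => hb _)
      simpa using this
    set c : ℝ := ε * θ / 2 with hc
    have hc0 : 0 < c := by positivity
    have hterm : ∀ n z, ediam (t n z) ^ s ≤ ENNReal.ofReal (Real.exp (bM * s)) *
        (ENNReal.ofReal (Real.exp (-c * z.1.1) / cpTc z.1.2) *
        ENNReal.ofReal (Real.exp (-c * z.2.1) / cpTc z.2.2)) := by
      intro n z
      by_cases hz : Good z.1.1 z.2.1 z.1.2 z.2.2
      · refine (ENNReal.rpow_le_rpow (hdiam n z) hs0.le).trans ?_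
        rw [ENNReal.ofReal_rpow_of_pos (by positivity), ← ENNReal.ofReal_mul (by positivity),
          ← ENNReal.ofReal_mul (by positivity)]
        refine ENNReal.ofReal_le_ofReal ?_
        obtain ⟨⟨m, u⟩, ⟨k, v⟩⟩ := z
        simp only at hz ⊢
        obtain ⟨g1, g2, g3⟩ := hz
        have tu : (0 : ℝ) < cpTc u := by exact_mod_cast cpTc_pos u
        have tv : (0 : ℝ) < cpTc v := by exact_mod_cast cpTc_pos v
        rw [← Real.exp_add, ← Real.exp_mul]
        have e1 : Real.exp (-c * m) / (cpTc u : ℝ) = Real.exp (-c * m - Real.log (cpTc u)) := by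
          rw [Real.exp_sub, Real.exp_log tu]
        have e2 : Real.exp (-c * k) / (cpTc v : ℝ) = Real.exp (-c * k - Real.log (cpTc v)) := by
          rw [Real.exp_sub, Real.exp_log tv]
        rw [e1, e2, ← Real.exp_add, ← Real.exp_add]
        refine Real.exp_le_exp.2 ?_
        have l1 := hSlow m u
        have l2 := hSlow2 k v
        have l3 := hSlow2 m (fun i => q (u i))
        have l4 : 0 ≤ (m : ℝ) * θ := by positivity
        set S := ∑ i, a (p (u i))
        have l5 : (k : ℝ) * θ ≤ S := by linarith
        have l6 : ε * (m * θ) ≤ ε * S := by gcongr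
        have l7 : ε * (k * θ) ≤ ε * S := by gcongr
        have l8 : c * m + c * k ≤ ε * S := by
          rw [hc]; nlinarith
        rw [hs]
        nlinarith
      · have : t n z = ∅ := by
          rw [ht]
          ext x
          simp only [Set.mem_ofPred_eq, Set.mem_empty_iff_false, iff_false]
          exact fun h => hz h.2.1
        rw [this, Metric.ediam_empty, ENNReal.zero_rpow_of_pos hs0]
        exact zero_le
    have hr : Tendsto (fun n : ℕ => ENNReal.ofReal (Real.exp bM * Real.exp (-(n * θ)))) atTop
        (nhds 0) := by
      have h1 : Tendsto (fun n : ℕ => (n : ℝ) * θ) atTop atTop :=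
        tendsto_natCast_atTop_atTop.atTop_mul_const hθ
      have h2 := (Real.tendsto_exp_neg_atTop_nhds_zero.comp h1).const_mul (Real.exp bM)
      have h3 := ENNReal.tendsto_ofReal h2
      simpa using h3
    have hH := MeasureTheory.Measure.hausdorffMeasure_le_liminf_tsum s
      ((fun ω => (Φ (p ∘ ω), Ψ (q ∘ ω))) '' G) _ hr t (Eventually.of_forall ?_)
      (Eventually.of_forall ?_)
    · refine ne_top_of_le_ne_top ?_ (hH.trans (liminf_le_of_le (f := atTop) (by isBoundedDefault)
        (a := ENNReal.ofReal (Real.exp (bM * s)) *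
          ((∑' z : (Σ m : ℕ, (Fin m → B)), ENNReal.ofReal (Real.exp (-c * z.1) / cpTc z.2)) *
          ∑' z : (Σ m : ℕ, (Fin m → J)), ENNReal.ofReal (Real.exp (-c * z.1) / cpTc z.2))) ?_))
      · exact ENNReal.mul_ne_top ENNReal.ofReal_ne_top
          (ENNReal.mul_ne_top (cp_zsum B hc0) (cp_zsum J hc0))
      · intro x hx
        obtain ⟨n, hn⟩ := hx.exists
        refine hn.trans ((ENNReal.tsum_le_tsum (hterm n)).trans (le_of_eq ?_))
        rw [ENNReal.tsum_mul_left]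
        congr 1
        exact cp_tsum_prod
          (fun z : (Σ m : ℕ, (Fin m → B)) => ENNReal.ofReal (Real.exp (-c * z.1) / cpTc z.2))
          (fun z : (Σ m : ℕ, (Fin m → J)) => ENNReal.ofReal (Real.exp (-c * z.1) / cpTc z.2))
    · intro n z
      by_cases hz : n ≤ z.1.1
      · refine (hdiam n z).trans (ENNReal.ofReal_le_ofReal ?_)
        have l1 := hSlow _ z.1.2
        have l2 : (n : ℝ) * θ ≤ z.1.1 * θ := by gcongr
        gcongr
        linarith
      · have : t n z = ∅ := by
          rw [ht]
          ext x
          simp only [Set.mem_ofPred_eq, Set.mem_empty_iff_false, iff_false]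
          exact fun h => hz h.1
        rw [this, Metric.ediam_empty]
        exact zero_le
    · intro n
      rintro _ ⟨ω, hω, rfl⟩
      obtain ⟨m, hm, k, h1, h2, h3⟩ := cp_good p q a b θ bM hθ ha hb hbM d hD ε hε ω (hG ω hω) n
      refine Set.mem_iUnion.2 ⟨(⟨m, fun i => ω i⟩, ⟨k, fun i => q (ω (m + i))⟩), ?_⟩
      exact ⟨hm, ⟨h1, h2, h3⟩, ω, fun _ => rfl, fun _ => rfl, rfl⟩
  refine ENNReal.le_of_forall_pos_le_add ?_
  intro ε hε _
  have h := main (ε / 2) (by positivity)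
  rw [ENNReal.ofReal_add hd (by positivity)] at h
  refine h.trans (le_of_eq ?_)
  congr 1
  rw [mul_div_cancel₀ _ (by norm_num : (2:ℝ) ≠ 0), ENNReal.ofReal_coe_nnreal]

theorem cp_upper {B I J : Type*} [Fintype B] [DecidableEq B] [Fintype J] [DecidableEq J]
    [Fintype I] [DecidableEq I]
    (p : B → I) (q : B → J) (a : I → ℝ) (b : J → ℝ)
    (ha : ∀ i, 0 < a i) (hb : ∀ j, 0 < b j)
    (Φ : (ℕ → I) → ℝ) (Ψ : (ℕ → J) → ℝ)
    (hΦ : ∀ (n : ℕ) (ω ω' : ℕ → I), (∀ k < n, ω k = ω' k) →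
      |Φ ω - Φ ω'| ≤ Real.exp (-∑ i : Fin n, a (ω i)))
    (hΨ : ∀ (n : ℕ) (ω ω' : ℕ → J), (∀ k < n, ω k = ω' k) →
      |Ψ ω - Ψ ω'| ≤ Real.exp (-∑ i : Fin n, b (ω i)))
    (d : ℝ) (hd : 0 ≤ d)
    (hD1 : ∀ (m : ℕ) (u : Fin m → B), 0 < m → ∑ i, b (q (u i)) ≤ ∑ i, a (p (u i)) →
      (Real.log (cpTc u) - Real.log (cpTc (q ∘ u))) / (∑ i, a (p (u i))) +
        Real.log (cpTc (q ∘ u)) / (∑ i, b (q (u i))) ≤ d)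
    (hD2 : ∀ (m : ℕ) (u : Fin m → B), 0 < m → ∑ i, a (p (u i)) ≤ ∑ i, b (q (u i)) →
      (Real.log (cpTc u) - Real.log (cpTc (p ∘ u))) / (∑ i, b (q (u i))) +
        Real.log (cpTc (p ∘ u)) / (∑ i, a (p (u i))) ≤ d) :
    dimH (Set.range (fun ω : ℕ → B => (Φ (p ∘ ω), Ψ (q ∘ ω)))) ≤ ENNReal.ofReal d := by
  obtain ⟨θ1, hθ1, hθa⟩ : ∃ θ > 0, ∀ i, θ ≤ a i := by
    rcases isEmpty_or_nonempty I with h | h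
    · exact ⟨1, one_pos, fun i => h.elim i⟩
    · obtain ⟨i, hi⟩ := Finite.exists_min a
      exact ⟨a i, ha i, hi⟩
  obtain ⟨θ2, hθ2, hθb⟩ : ∃ θ > 0, ∀ i, θ ≤ b i := by
    rcases isEmpty_or_nonempty J with h | h
    · exact ⟨1, one_pos, fun i => h.elim i⟩
    · obtain ⟨i, hi⟩ := Finite.exists_min b
      exact ⟨b i, hb i, hi⟩
  obtain ⟨M1, hM1, hMa⟩ : ∃ M ≥ 0, ∀ i, a i ≤ M := by
    rcases isEmpty_or_nonempty I with h | h
    · exact ⟨1, zero_le_one, fun i => h.elim i⟩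
    · obtain ⟨i, hi⟩ := Finite.exists_max a
      exact ⟨a i, (ha i).le, hi⟩
  obtain ⟨M2, hM2, hMb⟩ : ∃ M ≥ 0, ∀ i, b i ≤ M := by
    rcases isEmpty_or_nonempty J with h | h
    · exact ⟨1, zero_le_one, fun i => h.elim i⟩
    · obtain ⟨i, hi⟩ := Finite.exists_max b
      exact ⟨b i, (hb i).le, hi⟩
  set G1 : Set (ℕ → B) := {ω | ∀ n, ∃ m ≥ n,
    ∑ i : Fin m, b (q (ω i)) ≤ ∑ i : Fin m, a (p (ω i))} with hG1
  set G2 : Set (ℕ → B) := {ω | ∀ n, ∃ m ≥ n,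
    ∑ i : Fin m, a (p (ω i)) ≤ ∑ i : Fin m, b (q (ω i))} with hG2
  have hθ : 0 < min θ1 θ2 := lt_min hθ1 hθ2
  have c1 := cp_cover p q a b (min θ1 θ2) M2 hθ (fun i => (min_le_left _ _).trans (hθa i))
    (fun i => (min_le_right _ _).trans (hθb i)) hMb hM2 Φ Ψ hΦ hΨ d hd hD1 G1 (fun ω h => h)
  have c2 := cp_cover q p b a (min θ1 θ2) M1 hθ (fun i => (min_le_right _ _).trans (hθb i))
    (fun i => (min_le_left _ _).trans (hθa i)) hMa hM1 Ψ Φ hΨ hΦ d hd hD2 G2 (fun ω h => h)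
  have hcov : Set.range (fun ω : ℕ → B => (Φ (p ∘ ω), Ψ (q ∘ ω))) ⊆
      ((fun ω => (Φ (p ∘ ω), Ψ (q ∘ ω))) '' G1) ∪
      (Prod.swap '' ((fun ω => (Ψ (q ∘ ω), Φ (p ∘ ω))) '' G2)) := by
    rintro _ ⟨ω, rfl⟩
    by_cases h : ω ∈ G1
    · exact Or.inl ⟨ω, h, rfl⟩
    · refine Or.inr ⟨_, ⟨ω, ?_, rfl⟩, rfl⟩
      simp only [hG1, Set.mem_ofPred_eq, not_forall, not_exists, not_and, not_le] at h
      obtain ⟨n, hn⟩ := h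
      intro m
      exact ⟨max m n, le_max_left _ _, (hn _ (le_max_right _ _)).le⟩
  have hiso : Isometry (Prod.swap : ℝ × ℝ → ℝ × ℝ) := by
    intro x y
    simp [Prod.edist_eq, max_comm]
  refine (dimH_mono hcov).trans ?_
  rw [dimH_union, hiso.dimH_image]
  exact max_le c1 c2



/-- A coordinate system: abstract one-dimensional IFS with coding map and open set condition. -/
structure CS (I : Type) where
  h : I → ℝ → ℝ
  maps : ∀ i, MapsTo (h i) (Icc (0:ℝ) 1) (Icc (0:ℝ) 1)
  inj : ∀ i, InjOn (h i) (Icc (0:ℝ) 1)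
  Φ : (ℕ → I) → ℝ
  Φ_mem : ∀ ω, Φ ω ∈ Icc (0:ℝ) 1
  Φ_eq : ∀ ω, Φ ω = h (ω 0) (Φ (fun k => ω (k + 1)))
  U : Set ℝ
  U_sub : U ⊆ Icc (0:ℝ) 1
  x0 : ℝ
  c0 : ℝ
  c0_pos : 0 < c0
  sub_U : Icc x0 (x0 + c0) ⊆ U
  h_U : ∀ i, h i '' U ⊆ U
  h_disj : Pairwise fun i i' => Disjoint (h i '' U) (h i' '' U)

def CS.Up {I : Type} (C : CS I) (a : I → ℝ) : Prop :=
  ∀ i, ∀ x ∈ Icc (0:ℝ) 1, ∀ y ∈ Icc (0:ℝ) 1, |C.h i x - C.h i y| ≤ Real.exp (-a i) * |x - y|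

def CS.Lo {I : Type} (C : CS I) (a : I → ℝ) : Prop :=
  ∀ i, ∀ x ∈ Icc (0:ℝ) 1, ∀ y ∈ Icc (0:ℝ) 1, Real.exp (-a i) * |x - y| ≤ |C.h i x - C.h i y|

lemma cw_append {I : Type} (h : I → ℝ → ℝ) (l l' : List I) (x : ℝ) :
    compWord h (l ++ l') x = compWord h l (compWord h l' x) := by
  induction l with
  | nil => simp [compWord]
  | cons i l ih => simp [compWord, ih]

lemma cw_maps {I : Type} {h : I → ℝ → ℝ} {S : Set ℝ} (hm : ∀ i, MapsTo (h i) S S) (l : List I) :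
    MapsTo (compWord h l) S S := by
  induction l with
  | nil => simpa [compWord] using mapsTo_id S
  | cons i l ih => exact (hm i).comp ih

lemma cw_inj {I : Type} {h : I → ℝ → ℝ} {S : Set ℝ} (hm : ∀ i, MapsTo (h i) S S)
    (hi : ∀ i, InjOn (h i) S) (l : List I) : InjOn (compWord h l) S := by
  induction l with
  | nil => simpa [compWord] using injOn_id S
  | cons i l ih => exact (hi i).comp ih (cw_maps hm l)

lemma cw_disj {I : Type} {h : I → ℝ → ℝ} {S U : Set ℝ} (hm : ∀ i, MapsTo (h i) S S)
    (hi : ∀ i, InjOn (h i) S) (hUS : U ⊆ S) (hU : ∀ i, h i '' U ⊆ U)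
    (hd : Pairwise fun i i' => Disjoint (h i '' U) (h i' '' U)) (l : List I) :
    ∀ l' : List I, l.length = l'.length → l ≠ l' →
      Disjoint (compWord h l '' U) (compWord h l' '' U) := by
  have hU' : ∀ i, MapsTo (h i) U U := fun i => mapsTo_iff_image_subset.2 (hU i)
  induction l with
  | nil => intro l' hl hne; exact absurd (List.length_eq_zero_iff.1 hl.symm).symm hne
  | cons i l ih =>
    intro l' hl hne
    cases l' with
    | nil => simp at hl
    | cons j l' =>
      rw [Set.disjoint_left]
      rintro _ ⟨x, hx, rfl⟩ ⟨y, hy, hxy⟩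
      have hx' : compWord h l x ∈ U := cw_maps hU' l hx
      have hy' : compWord h l' y ∈ U := cw_maps hU' l' hy
      by_cases hij : i = j
      · subst hij
        have h1 : compWord h l' y = compWord h l x := hi i (hUS hy') (hUS hx') hxy
        have hll : l ≠ l' := fun h => hne (by rw [h])
        exact Set.disjoint_left.1 (ih l' (by simpa using hl) hll) ⟨x, hx, rfl⟩ ⟨y, hy, h1⟩
      · exact Set.disjoint_left.1 (hd hij) ⟨_, hx', rfl⟩ ⟨_, hy', hxy⟩

lemma cw_up {I : Type} (C : CS I) {a : I → ℝ} (ha : C.Up a) (l : List I) :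
    ∀ x ∈ Icc (0:ℝ) 1, ∀ y ∈ Icc (0:ℝ) 1,
      |compWord C.h l x - compWord C.h l y| ≤ Real.exp (-(l.map a).sum) * |x - y| := by
  induction l with
  | nil => intro x _ y _; simp [compWord]
  | cons i l ih =>
    intro x hx y hy
    have h1 := ha i _ (cw_maps C.maps l hx) _ (cw_maps C.maps l hy)
    have h2 := mul_le_mul_of_nonneg_left (ih x hx y hy) (Real.exp_pos (-a i)).le
    rw [← mul_assoc, ← Real.exp_add] at h2
    refine (h1.trans h2).trans (le_of_eq ?_)
    simp only [List.map_cons, List.sum_cons]; congr 2; ring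

lemma cw_lo {I : Type} (C : CS I) {a : I → ℝ} (ha : C.Lo a) (l : List I) :
    ∀ x ∈ Icc (0:ℝ) 1, ∀ y ∈ Icc (0:ℝ) 1,
      Real.exp (-(l.map a).sum) * |x - y| ≤ |compWord C.h l x - compWord C.h l y| := by
  induction l with
  | nil => intro x _ y _; simp [compWord]
  | cons i l ih =>
    intro x hx y hy
    have h1 := ha i _ (cw_maps C.maps l hx) _ (cw_maps C.maps l hy)
    have h2 := mul_le_mul_of_nonneg_left (ih x hx y hy) (Real.exp_pos (-a i)).le
    rw [← mul_assoc, ← Real.exp_add] at h2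
    refine (le_of_eq ?_).trans (h2.trans h1)
    simp only [List.map_cons, List.sum_cons]; congr 2; ring

def cpCat {I : Type} {N : ℕ} (hN : 0 < N) (ω : ℕ → Fin N → I) (k : ℕ) : I :=
  ω (k / N) ⟨k % N, Nat.mod_lt _ hN⟩

lemma cpCat_lt {I : Type} {N : ℕ} (hN : 0 < N) (ω : ℕ → Fin N → I) (k : Fin N) :
    cpCat hN ω k = ω 0 k := by
  unfold cpCat
  have h1 : (k : ℕ) / N = 0 := Nat.div_eq_of_lt k.2
  have h2 : (⟨(k : ℕ) % N, Nat.mod_lt _ hN⟩ : Fin N) = k := by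
    ext; exact Nat.mod_eq_of_lt k.2
  rw [h1, h2]

lemma cpCat_add {I : Type} {N : ℕ} (hN : 0 < N) (ω : ℕ → Fin N → I) (k : ℕ) :
    cpCat hN ω (k + N) = cpCat hN (fun j => ω (j + 1)) k := by
  unfold cpCat
  have h1 : (k + N) / N = k / N + 1 := Nat.add_div_right k hN
  have h2 : (⟨(k + N) % N, Nat.mod_lt _ hN⟩ : Fin N) = ⟨k % N, Nat.mod_lt _ hN⟩ := by
    ext; simp
  rw [h1, h2]

lemma cpCat_surj {I : Type} {N : ℕ} (hN : 0 < N) (ω : ℕ → I) :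
    cpCat hN (fun k j => ω (N * k + j)) = ω := by
  funext k
  unfold cpCat
  simp only [Nat.div_add_mod]

lemma cs_iter {I : Type} (C : CS I) (n : ℕ) : ∀ ω : ℕ → I,
    C.Φ ω = compWord C.h (List.ofFn fun k : Fin n => ω k) (C.Φ fun k => ω (k + n)) := by
  induction n with
  | zero => intro ω; simp [compWord]
  | succ n ih =>
    intro ω
    rw [C.Φ_eq ω, List.ofFn_succ]
    simp only [compWord, Function.comp_apply, Fin.val_zero, Fin.val_succ]
    rw [ih (fun k => ω (k + 1))]
    simp only [Nat.add_assoc, Nat.add_comm 1 n]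

/-- Block coordinate system. -/
def CS.block {I : Type} (C : CS I) {N : ℕ} (hN : 0 < N) : CS (Fin N → I) where
  h w := compWord C.h (List.ofFn w)
  maps w := cw_maps C.maps _
  inj w := cw_inj C.maps C.inj _
  Φ ω := C.Φ (cpCat hN ω)
  Φ_mem ω := C.Φ_mem _
  Φ_eq ω := by
    rw [cs_iter C N]
    simp only [cpCat_lt, cpCat_add]
  U := C.U
  U_sub := C.U_sub
  x0 := C.x0
  c0 := C.c0
  c0_pos := C.c0_pos
  sub_U := C.sub_U
  h_U w := mapsTo_iff_image_subset.1
    (cw_maps (fun i => mapsTo_iff_image_subset.2 (C.h_U i)) _)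
  h_disj w w' hw := cw_disj C.maps C.inj C.U_sub C.h_U C.h_disj _ _ (by simp)
    (fun h => hw (List.ofFn_injective h))

lemma CS.block_up {I : Type} (C : CS I) {N : ℕ} (hN : 0 < N) {a : I → ℝ} (ha : C.Up a) :
    (C.block hN).Up (fun w => ∑ k, a (w k)) := by
  intro w x hx y hy
  have := cw_up C ha (List.ofFn w) x hx y hy
  rw [List.map_ofFn, List.sum_ofFn] at this
  exact this

lemma CS.block_lo {I : Type} (C : CS I) {N : ℕ} (hN : 0 < N) {a : I → ℝ} (ha : C.Lo a) :
    (C.block hN).Lo (fun w => ∑ k, a (w k)) := by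
  intro w x hx y hy
  have := cw_lo C ha (List.ofFn w) x hx y hy
  rw [List.map_ofFn, List.sum_ofFn] at this
  exact this

def CS.comap {I I' : Type} (C : CS I) (e : I' → I) (he : Function.Injective e) : CS I' where
  h i := C.h (e i)
  maps i := C.maps _
  inj i := C.inj _
  Φ ω := C.Φ (e ∘ ω)
  Φ_mem ω := C.Φ_mem _
  Φ_eq ω := C.Φ_eq _
  U := C.U
  U_sub := C.U_sub
  x0 := C.x0
  c0 := C.c0
  c0_pos := C.c0_pos
  sub_U := C.sub_U
  h_U i := C.h_U _
  h_disj i i' hi := C.h_disj (he.ne hi)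

lemma CS.hΦ {I : Type} (C : CS I) {a : I → ℝ} (ha : C.Up a) (n : ℕ) (ω ω' : ℕ → I)
    (h : ∀ k < n, ω k = ω' k) :
    |C.Φ ω - C.Φ ω'| ≤ Real.exp (-∑ i : Fin n, a (ω i)) := by
  rw [cs_iter C n ω, cs_iter C n ω']
  have : (fun k : Fin n => ω' k) = fun k : Fin n => ω k := by
    funext k; exact (h k k.2).symm
  rw [this]
  have h1 := cw_up C ha (List.ofFn fun k : Fin n => ω k) _ (C.Φ_mem fun k => ω (k + n)) _
    (C.Φ_mem fun k => ω' (k + n))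
  rw [List.map_ofFn, List.sum_ofFn] at h1
  refine h1.trans ?_
  have h2 := C.Φ_mem fun k => ω (k + n)
  have h3 := C.Φ_mem fun k => ω' (k + n)
  have h4 : |(C.Φ fun k => ω (k + n)) - C.Φ fun k => ω' (k + n)| ≤ 1 := by
    rw [abs_le]; constructor <;> linarith [h2.1, h2.2, h3.1, h3.2]
  exact mul_le_of_le_one_right (Real.exp_pos _).le h4

/-- Counting lemma. -/
lemma CS.count {I : Type} [Fintype I] [Nonempty I] (C : CS I) {t t' : ℝ}
    (hu : C.Up fun _ => t) (hl : C.Lo fun _ => t') (x r : ℝ) (hr : 0 ≤ r) (S : Finset I)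
    (hS : ∀ i ∈ S, ∃ ω : ℕ → I, ω 0 = i ∧ |C.Φ ω - x| ≤ r) :
    (S.card : ℝ) * (C.c0 * Real.exp (-t')) ≤ 2 * r + 2 * Real.exp (-t) := by
  set K : I → Set ℝ := fun i => C.h i '' Icc C.x0 (C.x0 + C.c0) with hK
  have hc := C.c0_pos
  have hsub : Icc C.x0 (C.x0 + C.c0) ⊆ Icc (0:ℝ) 1 := C.sub_U.trans C.U_sub
  have hcont : ∀ i, ContinuousOn (C.h i) (Icc (0:ℝ) 1) := by
    intro i
    have : LipschitzOnWith (Real.toNNReal (Real.exp (-t))) (C.h i) (Icc (0:ℝ) 1) := by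
      apply LipschitzOnWith.of_dist_le_mul
      intro x hx y hy
      rw [Real.coe_toNNReal _ (Real.exp_pos _).le, Real.dist_eq, Real.dist_eq]
      exact hu i x hx y hy
    exact this.continuousOn
  have hKc : ∀ i, IsCompact (K i) := fun i => isCompact_Icc.image_of_continuousOn
    ((hcont i).mono hsub)
  have hKd : Pairwise fun i i' => Disjoint (K i) (K i') := fun i i' h =>
    (C.h_disj h).mono (image_mono C.sub_U) (image_mono C.sub_U)
  have hm0 : C.x0 ∈ Icc C.x0 (C.x0 + C.c0) := ⟨le_rfl, by linarith⟩
  have hm1 : C.x0 + C.c0 ∈ Icc C.x0 (C.x0 + C.c0) := ⟨by linarith, le_rfl⟩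
  have hvol : ∀ i, ENNReal.ofReal (C.c0 * Real.exp (-t')) ≤ volume (K i) := by
    intro i
    have h1 : uIcc (C.h i C.x0) (C.h i (C.x0 + C.c0)) ⊆ K i := by
      have hp : (K i).OrdConnected :=
        ((isPreconnected_Icc.image _ ((hcont i).mono hsub))).ordConnected
      exact hp.uIcc_subset ⟨_, hm0, rfl⟩ ⟨_, hm1, rfl⟩
    refine le_trans ?_ (measure_mono h1)
    rw [Real.volume_interval]
    apply ENNReal.ofReal_le_ofReal
    have := hl i _ (hsub hm1) _ (hsub hm0)
    have h2 : |C.x0 + C.c0 - C.x0| = C.c0 := by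
      rw [add_sub_cancel_left, abs_of_pos hc]
    rw [h2] at this; linarith
  have hin : ∀ i ∈ S, K i ⊆ Icc (x - r - Real.exp (-t)) (x + r + Real.exp (-t)) := by
    rintro i hi _ ⟨y, hy, rfl⟩
    obtain ⟨ω, h0, hω⟩ := hS i hi
    have h1 := hu i y (hsub hy) _ (C.Φ_mem fun k => ω (k + 1))
    rw [← h0, ← C.Φ_eq ω, h0] at h1
    have h3 := C.Φ_mem fun k => ω (k + 1)
    have h4 : |y - C.Φ fun k => ω (k + 1)| ≤ 1 := by
      have := hsub hy
      rw [abs_le]; constructor <;> linarith [this.1, this.2, h3.1, h3.2]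
    have h5 : |C.h i y - C.Φ ω| ≤ Real.exp (-t) :=
      h1.trans (mul_le_of_le_one_right (Real.exp_pos _).le h4)
    rw [abs_le] at h5 hω
    constructor <;> linarith [h5.1, h5.2, hω.1, hω.2]
  have hun : volume (⋃ i ∈ S, K i) = ∑ i ∈ S, volume (K i) :=
    measure_biUnion_finset (fun i _ j _ hij => hKd hij) (fun i _ => (hKc i).measurableSet)
  have h6 : ∑ i ∈ S, volume (K i) ≤ ENNReal.ofReal (2 * r + 2 * Real.exp (-t)) := by
    rw [← hun]
    refine (measure_mono (iUnion₂_subset hin)).trans ?_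
    rw [Real.volume_Icc]
    apply ENNReal.ofReal_le_ofReal; linarith
  have h7 : (S.card : ℝ≥0∞) * ENNReal.ofReal (C.c0 * Real.exp (-t')) ≤
      ENNReal.ofReal (2 * r + 2 * Real.exp (-t)) := by
    refine le_trans ?_ h6
    rw [← nsmul_eq_mul]
    exact Finset.card_nsmul_le_sum _ _ _ fun i _ => hvol i
  have h8 : (0:ℝ) ≤ 2 * r + 2 * Real.exp (-t) := by positivity
  rw [← ENNReal.ofReal_natCast, ← ENNReal.ofReal_mul (by positivity)] at h7
  exact (ENNReal.ofReal_le_ofReal_iff h8).1 h7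


lemma cf_cont {Λ : Type} (F : ConformalIFS Λ) (i : Λ) : ContinuousOn (F.f i) (Icc (0:ℝ) 1) :=
  fun x hx => (F.hasDeriv i x hx).continuousWithinAt

lemma cf_holder {Λ : Type} [Fintype Λ] (F : ConformalIFS Λ) :
    ∃ C : ℝ, 0 ≤ C ∧ ∀ i, ∀ x ∈ Icc (0:ℝ) 1, ∀ y ∈ Icc (0:ℝ) 1,
      |F.f' i x - F.f' i y| ≤ C * |x - y| ^ F.exponent := by
  choose c hc using F.holder
  obtain ⟨M, hM⟩ := (Set.finite_range c).bddAbove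
  refine ⟨max M 0, le_max_right _ _, fun i x hx y hy => (hc i x hx y hy).trans ?_⟩
  have : c i ≤ max M 0 := (hM ⟨i, rfl⟩).trans (le_max_left _ _)
  gcongr

lemma cf_lower {Λ : Type} [Fintype Λ] (F : ConformalIFS Λ) :
    ∃ c : ℝ, 0 < c ∧ ∀ i, ∀ x ∈ Icc (0:ℝ) 1, c ≤ |F.f' i x| := by
  obtain ⟨C, hC0, hC⟩ := cf_holder F
  have hcont : ∀ i, ContinuousOn (F.f' i) (Icc (0:ℝ) 1) := by
    intro i
    have : HolderOnWith (Real.toNNReal C) (Real.toNNReal F.exponent) (F.f' i) (Icc (0:ℝ) 1) := by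
      intro x hx y hy
      have h1 := hC i x hx y hy
      rw [edist_dist, edist_dist, Real.dist_eq, Real.dist_eq,
        ENNReal.ofReal_rpow_of_nonneg (abs_nonneg _) (by positivity),
        Real.coe_toNNReal _ F.exponent_pos.le]
      change _ ≤ ENNReal.ofReal C * _
      rw [← ENNReal.ofReal_mul hC0]
      exact ENNReal.ofReal_le_ofReal h1
    exact this.continuousOn (by simpa using F.exponent_pos)
  have h1 : ∀ i, ∃ c : ℝ, 0 < c ∧ ∀ x ∈ Icc (0:ℝ) 1, c ≤ |F.f' i x| := by
    intro i
    obtain ⟨x, hx, hm⟩ := (isCompact_Icc (a := (0:ℝ)) (b := 1)).exists_isMinOn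
      ⟨0, by simp⟩ (hcont i).abs
    exact ⟨|F.f' i x|, abs_pos.2 (F.nonvanishing i x hx), fun y hy => hm hy⟩
  choose c hc hc' using h1
  obtain ⟨M, hM⟩ := (Set.finite_range fun i => (c i)⁻¹).bddAbove
  refine ⟨(max M 1)⁻¹, by positivity, fun i x hx => le_trans ?_ (hc' i x hx)⟩
  have : (c i)⁻¹ ≤ max M 1 := (hM ⟨i, rfl⟩).trans (le_max_left _ _)
  exact inv_le_of_inv_le₀ (hc i) this

lemma cf_mvt {Λ : Type} (F : ConformalIFS Λ) (i : Λ) {x y : ℝ} (hx : x ∈ Icc (0:ℝ) 1)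
    (hy : y ∈ Icc (0:ℝ) 1) :
    ∃ ξ ∈ Icc (min x y) (max x y), F.f i x - F.f i y = F.f' i ξ * (x - y) := by
  have key : ∀ x y : ℝ, x ∈ Icc (0:ℝ) 1 → y ∈ Icc (0:ℝ) 1 → x < y →
      ∃ ξ ∈ Icc x y, F.f i x - F.f i y = F.f' i ξ * (x - y) := by
    intro x y hx hy hxy
    obtain ⟨ξ, hξ, h⟩ := exists_hasDerivAt_eq_slope (F.f i) (F.f' i) hxy
      ((cf_cont F i).mono (Icc_subset_Icc hx.1 hy.2)) (fun z hz =>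
        (F.hasDeriv i z ⟨hx.1.trans hz.1.le, hz.2.le.trans hy.2⟩).hasDerivAt
          (Icc_mem_nhds (hx.1.trans_lt hz.1) (hz.2.trans_le hy.2)))
    refine ⟨ξ, Ioo_subset_Icc_self hξ, ?_⟩
    rw [h]; field_simp [(sub_pos.2 hxy).ne']; ring
  rcases lt_trichotomy x y with h | h | h
  · rw [min_eq_left h.le, max_eq_right h.le]; exact key x y hx hy h
  · subst h; exact ⟨x, by simp, by simp⟩
  · rw [min_eq_right h.le, max_eq_left h.le]
    obtain ⟨ξ, h1, h2⟩ := key y x hy hx h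
    exact ⟨ξ, h1, by linarith⟩

lemma cf_inj {Λ : Type} (F : ConformalIFS Λ) (i : Λ) : InjOn (F.f i) (Icc (0:ℝ) 1) := by
  intro x hx y hy hxy
  obtain ⟨ξ, hξ, h⟩ := cf_mvt F i hx hy
  have hξ' : ξ ∈ Icc (0:ℝ) 1 := ⟨(le_min hx.1 hy.1).trans hξ.1, hξ.2.trans (max_le hx.2 hy.2)⟩
  rw [hxy, sub_self, eq_comm, mul_eq_zero] at h
  rcases h with h | h
  · exact absurd h (F.nonvanishing i ξ hξ')
  · linarith

lemma cf_dist1 {Λ : Type} [Fintype Λ] (F : ConformalIFS Λ) :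
    ∃ K : ℝ, 0 ≤ K ∧ ∀ i, ∀ δ : ℝ, 0 ≤ δ → ∀ x ∈ Icc (0:ℝ) 1, ∀ y ∈ Icc (0:ℝ) 1,
      ∀ x' ∈ Icc (0:ℝ) 1, ∀ y' ∈ Icc (0:ℝ) 1, |x - x'| ≤ δ → |x - y'| ≤ δ → |y - x'| ≤ δ →
      |y - y'| ≤ δ → |F.f i x - F.f i y| * |x' - y'| ≤
        Real.exp (K * δ ^ F.exponent) * (|F.f i x' - F.f i y'| * |x - y|) := by
  obtain ⟨C, hC0, hC⟩ := cf_holder F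
  obtain ⟨c, hc0, hc⟩ := cf_lower F
  refine ⟨C / c, by positivity, ?_⟩
  intro i δ hδ x hx y hy x' hx' y' hy' h1 h2 h3 h4
  obtain ⟨ξ, hξ, e⟩ := cf_mvt F i hx hy
  obtain ⟨ξ', hξ', e'⟩ := cf_mvt F i hx' hy'
  have mξ : ξ ∈ Icc (0:ℝ) 1 := ⟨(le_min hx.1 hy.1).trans hξ.1, hξ.2.trans (max_le hx.2 hy.2)⟩
  have mξ' : ξ' ∈ Icc (0:ℝ) 1 :=
    ⟨(le_min hx'.1 hy'.1).trans hξ'.1, hξ'.2.trans (max_le hx'.2 hy'.2)⟩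
  have hd : |ξ - ξ'| ≤ δ := by
    rw [abs_le] at h1 h2 h3 h4
    have := hξ.1; have := hξ.2; have := hξ'.1; have := hξ'.2
    rw [abs_le]
    rcases le_total x y with h | h <;> rcases le_total x' y' with h' | h' <;>
      simp only [h, h', min_eq_left, min_eq_right, max_eq_left, max_eq_right] at * <;>
      constructor <;> linarith [h1.1, h1.2, h2.1, h2.2, h3.1, h3.2, h4.1, h4.2]
  rw [e, e', abs_mul, abs_mul]
  have hf : |F.f' i ξ| ≤ Real.exp (C / c * δ ^ F.exponent) * |F.f' i ξ'| := by
    have a1 := hC i ξ mξ ξ' mξ'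
    have a2 : |ξ - ξ'| ^ F.exponent ≤ δ ^ F.exponent :=
      Real.rpow_le_rpow (abs_nonneg _) hd F.exponent_pos.le
    have a3 : |F.f' i ξ| ≤ |F.f' i ξ'| + |F.f' i ξ - F.f' i ξ'| := by
      have := abs_add_le (F.f' i ξ') (F.f' i ξ - F.f' i ξ')
      simpa using this
    have a4 := hc i ξ' mξ'
    have a5 := Real.add_one_le_exp (C / c * δ ^ F.exponent)
    have a6 : C * δ ^ F.exponent ≤ C / c * δ ^ F.exponent * |F.f' i ξ'| := by
      have : C * δ ^ F.exponent = C / c * δ ^ F.exponent * c := by field_simp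
      rw [this]; gcongr
    have a7 := mul_le_mul_of_nonneg_right a5 (abs_nonneg (F.f' i ξ'))
    have a8 := mul_le_mul_of_nonneg_left a2 hC0
    linarith
  calc |F.f' i ξ| * |x - y| * |x' - y'| ≤
        Real.exp (C / c * δ ^ F.exponent) * |F.f' i ξ'| * |x - y| * |x' - y'| := by gcongr
    _ = _ := by ring

lemma cf_contr {Λ : Type} (F : ConformalIFS Λ) (l : List Λ) :
    ∀ x ∈ Icc (0:ℝ) 1, ∀ y ∈ Icc (0:ℝ) 1,
      |compWord F.f l x - compWord F.f l y| ≤ F.ratio ^ l.length * |x - y| := by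
  induction l with
  | nil => intro x _ y _; simp [compWord]
  | cons i l ih =>
    intro x hx y hy
    have h1 := F.contracting i _ (cw_maps F.mapsTo l hx) _ (cw_maps F.mapsTo l hy)
    have h2 := mul_le_mul_of_nonneg_left (ih x hx y hy) F.ratio_pos.le
    refine (h1.trans h2).trans (le_of_eq ?_)
    rw [List.length_cons, pow_succ]; ring

lemma cp_abs01 {x y : ℝ} (hx : x ∈ Icc (0:ℝ) 1) (hy : y ∈ Icc (0:ℝ) 1) : |x - y| ≤ 1 := by
  rw [abs_le]; constructor <;> linarith [hx.1, hx.2, hy.1, hy.2]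

lemma cf_dist {Λ : Type} [Fintype Λ] (F : ConformalIFS Λ) :
    ∃ L : ℝ, 0 ≤ L ∧ ∀ l : List Λ, ∀ x ∈ Icc (0:ℝ) 1, ∀ y ∈ Icc (0:ℝ) 1,
      ∀ x' ∈ Icc (0:ℝ) 1, ∀ y' ∈ Icc (0:ℝ) 1,
      |compWord F.f l x - compWord F.f l y| * |x' - y'| ≤
        Real.exp L * (|compWord F.f l x' - compWord F.f l y'| * |x - y|) := by
  obtain ⟨K, hK, hd⟩ := cf_dist1 F
  set ρ := F.ratio ^ F.exponent with hρ
  have hρ0 : 0 ≤ ρ := Real.rpow_nonneg F.ratio_pos.le _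
  have hρ1 : ρ < 1 := Real.rpow_lt_one F.ratio_pos.le F.ratio_lt_one F.exponent_pos
  have hpow : ∀ n : ℕ, (F.ratio ^ n) ^ F.exponent = ρ ^ n := by
    intro n
    rw [hρ, ← Real.rpow_natCast, ← Real.rpow_natCast, ← Real.rpow_mul F.ratio_pos.le,
      ← Real.rpow_mul F.ratio_pos.le, mul_comm]
  have main : ∀ l : List Λ, ∀ x ∈ Icc (0:ℝ) 1, ∀ y ∈ Icc (0:ℝ) 1,
      ∀ x' ∈ Icc (0:ℝ) 1, ∀ y' ∈ Icc (0:ℝ) 1,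
      |compWord F.f l x - compWord F.f l y| * |x' - y'| ≤
        Real.exp (K * ∑ k ∈ Finset.range l.length, ρ ^ k) *
          (|compWord F.f l x' - compWord F.f l y'| * |x - y|) := by
    intro l
    induction l with
    | nil => intro x _ y _ x' _ y' _; simp [compWord, mul_comm]
    | cons i l ih =>
      intro x hx y hy x' hx' y' hy'
      have ih' := ih x hx y hy x' hx' y' hy'
      have m := @cw_maps Λ F.f (Icc (0:ℝ) 1) F.mapsTo l
      have hδ : ∀ u ∈ Icc (0:ℝ) 1, ∀ v ∈ Icc (0:ℝ) 1,
          |compWord F.f l u - compWord F.f l v| ≤ F.ratio ^ l.length := fun u hu v hv =>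
        (cf_contr F l u hu v hv).trans
          (mul_le_of_le_one_right (pow_nonneg F.ratio_pos.le _) (cp_abs01 hu hv))
      have h1 := hd i (F.ratio ^ l.length) (pow_nonneg F.ratio_pos.le _) _ (m hx) _ (m hy) _
        (m hx') _ (m hy') (hδ x hx x' hx') (hδ x hx y' hy') (hδ y hy x' hx') (hδ y hy y' hy')
      rw [hpow] at h1
      simp only [compWord, Function.comp_apply, List.length_cons, Finset.sum_range_succ]
      rw [mul_add, Real.exp_add]
      set X := compWord F.f l x
      set Y := compWord F.f l y
      set X' := compWord F.f l x' with hX'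
      set Y' := compWord F.f l y' with hY'
      set E := Real.exp (K * ∑ k ∈ Finset.range l.length, ρ ^ k)
      set e := Real.exp (K * ρ ^ l.length)
      have hE : 0 ≤ E := (Real.exp_pos _).le
      have he : 0 ≤ e := (Real.exp_pos _).le
      by_cases hXY : X' = Y'
      · have : x' = y' := cw_inj F.mapsTo (cf_inj F) l hx' hy' hXY
        subst this
        rw [sub_self, abs_zero, mul_zero]
        positivity
      · have hpos : 0 < |X' - Y'| := abs_pos.2 (sub_ne_zero.2 hXY)
        refine le_of_mul_le_mul_right ?_ hpos
        calc |F.f i X - F.f i Y| * |x' - y'| * |X' - Y'| =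
            |F.f i X - F.f i Y| * |X' - Y'| * |x' - y'| := by ring
          _ ≤ e * (|F.f i X' - F.f i Y'| * |X - Y|) * |x' - y'| := by gcongr
          _ = e * |F.f i X' - F.f i Y'| * (|X - Y| * |x' - y'|) := by ring
          _ ≤ e * |F.f i X' - F.f i Y'| * (E * (|X' - Y'| * |x - y|)) := by gcongr
          _ = _ := by ring
  refine ⟨K * (1 - ρ)⁻¹, mul_nonneg hK (inv_nonneg.2 (by linarith)), ?_⟩
  intro l x hx y hy x' hx' y' hy'
  refine (main l x hx y hy x' hx' y' hy').trans ?_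
  have : ∑ k ∈ Finset.range l.length, ρ ^ k ≤ (1 - ρ)⁻¹ := by
    rw [← tsum_geometric_of_lt_one hρ0 hρ1]
    exact (summable_geometric_of_lt_one hρ0 hρ1).sum_le_tsum _ (fun k _ => pow_nonneg hρ0 k)
  gcongr

lemma cs_dist {Λ : Type} [Fintype Λ] (F : ConformalIFS Λ) (C : CS Λ) (hC : C.h = F.f)
    (κ : ℝ) (hκ : 0 < κ) : ∃ N0 : ℕ, ∀ N : ℕ, N0 ≤ N → ∀ hN : 0 < N,
      ∃ a : (Fin N → Λ) → ℝ, (∀ w, 0 < a w) ∧ (C.block hN).Up a ∧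
        (C.block hN).Lo (fun w => (1 + κ) * a w) := by
  obtain ⟨L, hL, hd⟩ := cf_dist F
  have hlog : 0 < -Real.log F.ratio := by
    have := Real.log_neg F.ratio_pos F.ratio_lt_one; linarith
  obtain ⟨N0, hN0⟩ := exists_nat_gt ((L + 1 + 2 * L / κ) / (-Real.log F.ratio))
  refine ⟨N0, fun N hNN hN => ?_⟩
  have z0 : (0:ℝ) ∈ Icc (0:ℝ) 1 := by simp
  have z1 : (1:ℝ) ∈ Icc (0:ℝ) 1 := by simp
  set R : (Fin N → Λ) → ℝ := fun w =>
    |compWord F.f (List.ofFn w) 0 - compWord F.f (List.ofFn w) 1| with hR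
  have hRpos : ∀ w, 0 < R w := fun w => abs_pos.2 (sub_ne_zero.2 fun h => by
    have := cw_inj F.mapsTo (cf_inj F) (List.ofFn w) z0 z1 h
    norm_num at this)
  have hRle : ∀ w, R w ≤ F.ratio ^ N := fun w => by
    have := cf_contr F (List.ofFn w) 0 z0 1 z1
    simpa using this
  have hlogR : ∀ w, L + 1 + 2 * L / κ ≤ - Real.log (R w) := by
    intro w
    have h1 : Real.log (R w) ≤ N * Real.log F.ratio := by
      rw [← Real.log_pow]; exact Real.log_le_log (hRpos w) (hRle w)
    rw [div_lt_iff₀ hlog] at hN0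
    have h2 : (N0 : ℝ) ≤ N := by exact_mod_cast hNN
    nlinarith
  have hq : 0 ≤ 2 * L / κ := by positivity
  refine ⟨fun w => -Real.log (R w) - L, fun w => by linarith [hlogR w], ?_, ?_⟩
  · intro w x hx y hy
    have h1 := hd (List.ofFn w) x hx y hy 0 z0 1 z1
    simp only [CS.block, hC]
    have h2 : Real.exp (-(-Real.log (R w) - L)) = Real.exp L * R w := by
      rw [show -(-Real.log (R w) - L) = L + Real.log (R w) by ring, Real.exp_add,
        Real.exp_log (hRpos w)]
    rw [h2]
    simp only [zero_sub, abs_neg, abs_one, mul_one] at h1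
    linarith
  · intro w x hx y hy
    have h1 := hd (List.ofFn w) 0 z0 1 z1 x hx y hy
    simp only [CS.block, hC]
    have h2 : Real.exp (-((1 + κ) * (-Real.log (R w) - L))) ≤ Real.exp (-L) * R w := by
      have h3 : Real.exp (-L) * R w = Real.exp (-L + Real.log (R w)) := by
        rw [Real.exp_add, Real.exp_log (hRpos w)]
      rw [h3, Real.exp_le_exp]
      have h4 := mul_le_mul_of_nonneg_left (hlogR w) hκ.le
      have h5 : κ * (L + 1 + 2 * L / κ) = κ * L + κ + 2 * L := by field_simp
      nlinarith
    simp only [zero_sub, abs_neg, abs_one, mul_one] at h1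
    calc _ ≤ Real.exp (-L) * R w * |x - y| := by gcongr
      _ = Real.exp (-L) * (R w * |x - y|) := by ring
      _ ≤ Real.exp (-L) * (Real.exp L * |compWord F.f (List.ofFn w) x - compWord F.f (List.ofFn w) y|) := by
        gcongr
      _ = _ := by rw [← mul_assoc, ← Real.exp_add]; simp

lemma cs_base {Λ : Type} (F : ConformalIFS Λ) (hF : CoordOSC F) :
    ∃ C : CS Λ, C.h = F.f ∧ ∀ ω : ℕ → Λ,
      Tendsto (fun n => compWord F.f ((List.range n).map ω) 0) atTop (nhds (C.Φ ω)) := by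
  obtain ⟨U, hne, hU1, ⟨O, hO, hUO⟩, himg, hdis⟩ := hF
  have z0 : (0:ℝ) ∈ Icc (0:ℝ) 1 := by simp
  have hlim : ∀ ω : ℕ → Λ, ∃ y, Tendsto (fun n => compWord F.f ((List.range n).map ω) 0)
      atTop (nhds y) := by
    intro ω
    apply cauchySeq_tendsto_of_complete
    refine cauchySeq_of_le_geometric F.ratio 1 F.ratio_lt_one fun n => ?_
    rw [List.range_succ, List.map_append, cw_append, Real.dist_eq]
    have h2 := cw_maps F.mapsTo (List.map ω [n]) z0
    have := cf_contr F ((List.range n).map ω) 0 z0 _ h2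
    refine this.trans ?_
    rw [one_mul]
    simp only [List.length_map, List.length_range]
    exact mul_le_of_le_one_right (pow_nonneg F.ratio_pos.le _) (cp_abs01 z0 h2)
  choose Φ hΦ using hlim
  have hmem : ∀ ω, Φ ω ∈ Icc (0:ℝ) 1 := fun ω =>
    isClosed_Icc.mem_of_tendsto (hΦ ω) (Eventually.of_forall fun n => cw_maps F.mapsTo _ z0)
  have heq : ∀ ω, Φ ω = F.f (ω 0) (Φ fun k => ω (k + 1)) := by
    intro ω
    have h1 := (tendsto_add_atTop_iff_nat 1).2 (hΦ ω)
    refine tendsto_nhds_unique h1 ?_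
    have h2 : (fun n => compWord F.f ((List.range (n + 1)).map ω) 0) = fun n =>
        F.f (ω 0) (compWord F.f ((List.range n).map fun k => ω (k + 1)) 0) := by
      funext n
      rw [List.range_succ_eq_map]
      simp [compWord, Function.comp_def]
    rw [h2]
    have h3 := cf_cont F (ω 0) _ (hmem fun k => ω (k + 1))
    exact h3.tendsto.comp (tendsto_nhdsWithin_iff.2 ⟨hΦ fun k => ω (k + 1),
      Eventually.of_forall fun n => cw_maps F.mapsTo _ z0⟩)
  have hxc0 : ∃ x0 c0 : ℝ, 0 < c0 ∧ Icc x0 (x0 + c0) ⊆ U := by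
    obtain ⟨x, hx⟩ := hne
    have hxO : x ∈ O := by rw [hUO] at hx; exact hx.1
    have hx1 := hU1 hx
    obtain ⟨δ, hδ, hb⟩ := Metric.isOpen_iff.1 hO x hxO
    by_cases h : x < 1
    · refine ⟨x, min (δ / 2) (1 - x), lt_min (by positivity) (by linarith), fun y hy => ?_⟩
      have m1 := min_le_left (δ / 2) (1 - x)
      have m2 := min_le_right (δ / 2) (1 - x)
      rw [hUO]
      refine ⟨hb ?_, by linarith [hx1.1, hy.1], by linarith [hy.2]⟩
      rw [Metric.mem_ball, Real.dist_eq, abs_lt]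
      constructor <;> linarith [hy.1, hy.2]
    · have hx1' : x = 1 := le_antisymm hx1.2 (not_lt.1 h)
      refine ⟨1 - min (δ / 2) 1, min (δ / 2) 1, lt_min (by positivity) (by linarith),
        fun y hy => ?_⟩
      have m1 := min_le_left (δ / 2) 1
      have m2 := min_le_right (δ / 2) 1
      rw [hUO]
      refine ⟨hb ?_, by linarith [hx1.1, hy.1], by linarith [hy.2]⟩
      rw [Metric.mem_ball, Real.dist_eq, abs_lt, hx1']
      constructor <;> linarith [hy.1, hy.2]
  obtain ⟨x0, c0, hc0, hsub⟩ := hxc0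
  exact ⟨⟨F.f, F.mapsTo, cf_inj F, Φ, hmem, heq, U, hU1, x0, c0, hc0, hsub, himg, hdis⟩, rfl, hΦ⟩


lemma cs_count2 {I : Type} [Fintype I] [Nonempty I] (C : CS I) {τ κ : ℝ} (hτ : 0 < τ)
    (hκ : 0 < κ) (hu : C.Up fun _ => τ) (hl : C.Lo fun _ => (1 + κ) * τ) :
    ∃ K : ℝ, 0 < K ∧ ∀ L : ℝ, 0 ≤ L → ∀ x : ℝ, ∀ n : ℕ, n = ⌊L / (τ * (1 + κ))⌋₊ + 1 →
      ∀ S : Finset (Fin n → I), (∀ v ∈ S, ∃ ω : ℕ → I, (∀ k : Fin n, ω k = v k) ∧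
        |C.Φ ω - x| ≤ Real.exp (-L)) → (S.card : ℝ) ≤ K * Real.exp (κ * L) := by
  have hc := C.c0_pos
  refine ⟨4 / C.c0 * Real.exp ((1 + κ) * τ), by positivity, ?_⟩
  intro L hL x n hn S hS
  have hn0 : 0 < n := by omega
  have hτκ : 0 < τ * (1 + κ) := by positivity
  have n1 : L ≤ n * (τ * (1 + κ)) := by
    have := (Nat.lt_floor_add_one (L / (τ * (1 + κ)))).le
    rw [div_le_iff₀ hτκ] at this
    rw [hn]; push_cast; exact this
  have n2 : n * (τ * (1 + κ)) ≤ L + τ * (1 + κ) := by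
    have := Nat.floor_le (a := L / (τ * (1 + κ))) (by positivity)
    rw [le_div_iff₀ hτκ] at this
    rw [hn]; push_cast; linarith
  have hu' := C.block_up hn0 hu
  have hl' := C.block_lo hn0 hl
  simp only [Finset.sum_const, Finset.card_univ, Fintype.card_fin, nsmul_eq_mul] at hu' hl'
  have h1 := (C.block hn0).count hu' hl' x (Real.exp (-L)) (Real.exp_pos _).le S (by
    intro v hv
    obtain ⟨ω, h1, h2⟩ := hS v hv
    refine ⟨fun k j => ω (n * k + j), ?_, ?_⟩
    · funext j; simp [h1]
    · change |C.Φ (cpCat hn0 _) - x| ≤ _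
      rw [cpCat_surj]; exact h2)
  change (S.card : ℝ) * (C.c0 * _) ≤ _ at h1
  have e1 : Real.exp (-L - (1 + κ) * τ) ≤ Real.exp (-(n * ((1 + κ) * τ))) := by
    rw [Real.exp_le_exp]; linarith
  have e2 : Real.exp (-(n * τ)) ≤ Real.exp (-L + κ * L) := by
    rw [Real.exp_le_exp]
    have h3 : L * (1 - κ) * (1 + κ) ≤ L := by nlinarith [mul_nonneg hL (sq_nonneg κ)]
    have h4 : L * (1 - κ) * (1 + κ) ≤ (n * τ) * (1 + κ) := by linarith
    have := le_of_mul_le_mul_right h4 (by linarith : (0:ℝ) < 1 + κ)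
    linarith
  have e3 : Real.exp (-L) ≤ Real.exp (-L + κ * L) := by
    rw [Real.exp_le_exp]; nlinarith [mul_nonneg hκ.le hL]
  have h2 : (S.card : ℝ) * (C.c0 * Real.exp (-L - (1 + κ) * τ)) ≤ 4 * Real.exp (-L + κ * L) := by
    calc _ ≤ (S.card : ℝ) * (C.c0 * Real.exp (-(n * ((1 + κ) * τ)))) := by gcongr
      _ ≤ _ := by linarith
  have h5 : (S.card : ℝ) ≤ 4 * Real.exp (-L + κ * L) / (C.c0 * Real.exp (-L - (1 + κ) * τ)) := by
    rw [le_div_iff₀ (by positivity)]; exact h2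
  refine h5.trans (le_of_eq ?_)
  rw [mul_div_mul_comm, ← Real.exp_sub, mul_assoc, ← Real.exp_add]
  congr 2; ring

/-- The uniform Bernoulli measure. -/
def cpBern (Γ : Type) [Fintype Γ] [Nonempty Γ] [MeasurableSpace Γ] : Measure (ℕ → Γ) :=
  Measure.infinitePi fun _ : ℕ => (PMF.uniformOfFintype Γ).toMeasure

instance cpBern_prob (Γ : Type) [Fintype Γ] [Nonempty Γ] [MeasurableSpace Γ] :
    IsProbabilityMeasure (cpBern Γ) := by unfold cpBern; infer_instance

open Classical in
lemma cp_cyl {Γ I J : Type} [Fintype Γ] [Nonempty Γ] [Fintype J]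
    [MeasurableSpace Γ] [DiscreteMeasurableSpace Γ] (p : Γ → I) (q : Γ → J)
    (hinj : Function.Injective fun γ => (p γ, q γ))
    (hfib : ∀ j, (Finset.univ.filter fun γ => q γ = j).card * Fintype.card J = Fintype.card Γ)
    {n1 n2 : ℕ} (hn : n1 ≤ n2) (v1 : Fin n1 → I) (v2 : Fin n2 → J) :
    cpBern Γ {ω | (∀ k : Fin n1, p (ω k) = v1 k) ∧ ∀ k : Fin n2, q (ω k) = v2 k} ≤
      ENNReal.ofReal (((Fintype.card Γ : ℝ)⁻¹) ^ n1 * ((Fintype.card J : ℝ)⁻¹) ^ (n2 - n1)) := by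
  set T : ℕ → Set Γ := fun k => {γ | (∀ h : k < n1, p γ = v1 ⟨k, h⟩) ∧
    ∀ h : k < n2, q γ = v2 ⟨k, h⟩} with hT
  have h1 : {ω : ℕ → Γ | (∀ k : Fin n1, p (ω k) = v1 k) ∧ ∀ k : Fin n2, q (ω k) = v2 k} =
      Set.pi (Finset.range n2 : Set ℕ) T := by
    ext ω
    simp only [hT, Set.mem_pi, Finset.coe_range, Set.mem_Iio]
    constructor
    · rintro ⟨a, b⟩ k hk
      exact ⟨fun h => a ⟨k, h⟩, fun h => b ⟨k, h⟩⟩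
    · intro h
      exact ⟨fun k => (h k (k.2.trans_le hn)).1 k.2, fun k => (h k k.2).2 k.2⟩
  have hG : (0:ℝ) < Fintype.card Γ := by exact_mod_cast Fintype.card_pos
  have γ0 : Γ := Classical.arbitrary Γ
  have hJ : (0:ℝ) < Fintype.card J := by exact_mod_cast Fintype.card_pos_iff.2 ⟨q γ0⟩
  rw [h1, cpBern, Measure.infinitePi_pi _ (fun _ _ => MeasurableSet.of_discrete)]
  have hun : ∀ S : Finset Γ, (PMF.uniformOfFintype Γ).toMeasure (S : Set Γ) =
      ENNReal.ofReal ((S.card : ℝ) / Fintype.card Γ) := by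
    intro S
    rw [PMF.toMeasure_uniformOfFintype_apply _ MeasurableSet.of_discrete,
      ENNReal.ofReal_div_of_pos hG]
    simp
  have b1 : ∀ k, k < n1 → (PMF.uniformOfFintype Γ).toMeasure (T k) ≤
      ENNReal.ofReal (Fintype.card Γ : ℝ)⁻¹ := by
    intro k hk
    have e : T k = (Finset.univ.filter fun γ => γ ∈ T k : Finset Γ) := by ext; simp
    rw [e, hun]
    apply ENNReal.ofReal_le_ofReal
    rw [div_eq_mul_inv]
    refine mul_le_of_le_one_left (by positivity) ?_
    have : (Finset.univ.filter fun γ => γ ∈ T k).card ≤ 1 := by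
      rw [Finset.card_le_one]
      intro a ha b hb
      simp only [Finset.mem_filter, Finset.mem_univ, true_and] at ha hb
      apply hinj
      exact Prod.ext ((ha.1 hk).trans (hb.1 hk).symm)
        ((ha.2 (hk.trans_le hn)).trans (hb.2 (hk.trans_le hn)).symm)
    exact_mod_cast this
  have b2 : ∀ k, k < n2 → (PMF.uniformOfFintype Γ).toMeasure (T k) ≤
      ENNReal.ofReal (Fintype.card J : ℝ)⁻¹ := by
    intro k hk
    have e : T k ⊆ (Finset.univ.filter fun γ => q γ = v2 ⟨k, hk⟩ : Finset Γ) := by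
      intro γ hγ; simpa using hγ.2 hk
    refine (measure_mono e).trans ?_
    rw [hun]
    apply ENNReal.ofReal_le_ofReal
    have := hfib (v2 ⟨k, hk⟩)
    have h3 : ((Finset.univ.filter fun γ => q γ = v2 ⟨k, hk⟩).card : ℝ) * Fintype.card J =
      Fintype.card Γ := by exact_mod_cast this
    rw [← h3]
    rw [← h3] at hG
    have : ((Finset.univ.filter fun γ => q γ = v2 ⟨k, hk⟩).card : ℝ) ≠ 0 := by
      intro h; rw [h] at hG; simp at hG
    apply le_of_eq
    field_simp
  have h4 : Finset.range n2 = Finset.range n1 ∪ Finset.Ico n1 n2 := by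
    ext k; simp only [Finset.mem_range, Finset.mem_union, Finset.mem_Ico]; omega
  rw [h4, Finset.prod_union (by
    rw [Finset.disjoint_left]; intro k; simp only [Finset.mem_range, Finset.mem_Ico]; omega),
    ENNReal.ofReal_mul (by positivity), ENNReal.ofReal_pow (by positivity),
    ENNReal.ofReal_pow (by positivity)]
  refine mul_le_mul' ?_ ?_
  · refine (Finset.prod_le_pow_card _ _ _ fun k hk => b1 k (Finset.mem_range.1 hk)).trans ?_
    simp
  · refine (Finset.prod_le_pow_card _ _ _ fun k hk => b2 k (Finset.mem_Ico.1 hk).2).trans ?_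
    simp

open Classical in
lemma cp_ball {Γ I J : Type} [Fintype Γ] [Nonempty Γ] [Fintype I] [Fintype J]
    [MeasurableSpace Γ] [DiscreteMeasurableSpace Γ] (p : Γ → I) (q : Γ → J)
    (hinj : Function.Injective fun γ => (p γ, q γ))
    (hfib : ∀ j, (Finset.univ.filter fun γ => q γ = j).card * Fintype.card J = Fintype.card Γ)
    (C : CS I) (D : CS J) {τ1 τ2 κ : ℝ} (hτ2 : 0 < τ2) (h12 : τ2 ≤ τ1)
    (hκ : 0 < κ) (hCu : C.Up fun _ => τ1) (hCl : C.Lo fun _ => (1 + κ) * τ1)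
    (hDu : D.Up fun _ => τ2) (hDl : D.Lo fun _ => (1 + κ) * τ2) :
    ∃ K : ℝ, 0 < K ∧ ∀ L : ℝ, 0 ≤ L → ∀ x y : ℝ,
      cpBern Γ {ω | |C.Φ (p ∘ ω) - x| ≤ Real.exp (-L) ∧ |D.Φ (q ∘ ω) - y| ≤ Real.exp (-L)} ≤
        ENNReal.ofReal (K * Real.exp (-((((Real.log (Fintype.card Γ) - Real.log (Fintype.card J)) / τ1
          + Real.log (Fintype.card J) / τ2) / (1 + κ) - 2 * κ) * L))) := by
  have γ0 : Γ := Classical.arbitrary Γ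
  haveI : Nonempty I := ⟨p γ0⟩
  haveI : Nonempty J := ⟨q γ0⟩
  have hτ1 : 0 < τ1 := hτ2.trans_le h12
  obtain ⟨K1, hK1, hc1⟩ := cs_count2 C hτ1 hκ hCu hCl
  obtain ⟨K2, hK2, hc2⟩ := cs_count2 D hτ2 hκ hDu hDl
  refine ⟨K1 * K2, by positivity, fun L hL x y => ?_⟩
  obtain ⟨n1, hn1⟩ : ∃ n, n = ⌊L / (τ1 * (1 + κ))⌋₊ + 1 := ⟨_, rfl⟩
  obtain ⟨n2, hn2⟩ : ∃ n, n = ⌊L / (τ2 * (1 + κ))⌋₊ + 1 := ⟨_, rfl⟩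
  have hn : n1 ≤ n2 := by
    rw [hn1, hn2]
    gcongr
  set S1 : Finset (Fin n1 → I) := Finset.univ.filter fun v => ∃ ω : ℕ → I,
    (∀ k : Fin n1, ω k = v k) ∧ |C.Φ ω - x| ≤ Real.exp (-L) with hS1
  set S2 : Finset (Fin n2 → J) := Finset.univ.filter fun v => ∃ ω : ℕ → J,
    (∀ k : Fin n2, ω k = v k) ∧ |D.Φ ω - y| ≤ Real.exp (-L) with hS2
  have k1 := hc1 L hL x n1 hn1 S1 (fun v hv => (Finset.mem_filter.1 hv).2)
  have k2 := hc2 L hL y n2 hn2 S2 (fun v hv => (Finset.mem_filter.1 hv).2)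
  have hsub : {ω : ℕ → Γ | |C.Φ (p ∘ ω) - x| ≤ Real.exp (-L) ∧
      |D.Φ (q ∘ ω) - y| ≤ Real.exp (-L)} ⊆ ⋃ v ∈ S1 ×ˢ S2,
      {ω | (∀ k : Fin n1, p (ω k) = v.1 k) ∧ ∀ k : Fin n2, q (ω k) = v.2 k} := by
    rintro ω ⟨h1, h2⟩
    simp only [Set.mem_iUnion]
    refine ⟨(fun k => p (ω k), fun k => q (ω k)), Finset.mem_product.2 ⟨?_, ?_⟩, ?_, ?_⟩
    · exact Finset.mem_filter.2 ⟨Finset.mem_univ _, p ∘ ω, fun k => rfl, h1⟩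
    · exact Finset.mem_filter.2 ⟨Finset.mem_univ _, q ∘ ω, fun k => rfl, h2⟩
    · intro k; rfl
    · intro k; rfl
  refine (measure_mono hsub).trans ((measure_biUnion_finset_le _ _).trans ?_)
  refine (Finset.sum_le_card_nsmul _ _ _ fun v _ => cp_cyl p q hinj hfib hn v.1 v.2).trans ?_
  rw [nsmul_eq_mul, ← ENNReal.ofReal_natCast, ← ENNReal.ofReal_mul (by positivity)]
  apply ENNReal.ofReal_le_ofReal
  rw [Finset.card_product]
  push_cast
  have hG : (0:ℝ) < Fintype.card Γ := by exact_mod_cast Fintype.card_pos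
  have hJ : (0:ℝ) < Fintype.card J := by exact_mod_cast Fintype.card_pos
  have hJ1 : (1:ℝ) ≤ Fintype.card J := by exact_mod_cast Fintype.card_pos (α := J)
  have hGJ : (Fintype.card J : ℝ) ≤ Fintype.card Γ := by
    have h0 := hfib (q γ0)
    have h1 : 0 < (Finset.univ.filter fun γ => q γ = q γ0).card :=
      Finset.card_pos.2 ⟨γ0, by simp⟩
    have : Fintype.card J ≤ Fintype.card Γ := by rw [← h0]; exact Nat.le_mul_of_pos_left _ h1
    exact_mod_cast this
  have hlJ : 0 ≤ Real.log (Fintype.card J) := Real.log_nonneg hJ1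
  have hlGJ : 0 ≤ Real.log (Fintype.card Γ) - Real.log (Fintype.card J) :=
    sub_nonneg.2 (Real.log_le_log hJ hGJ)
  have f1 : L / (τ1 * (1 + κ)) ≤ n1 := by
    rw [hn1]; push_cast; exact (Nat.lt_floor_add_one _).le
  have f2 : L / (τ2 * (1 + κ)) ≤ n2 := by
    rw [hn2]; push_cast; exact (Nat.lt_floor_add_one _).le
  set lG := Real.log (Fintype.card Γ) with hlG'
  set lJ := Real.log (Fintype.card J) with hlJ'
  have hm : ((Fintype.card Γ : ℝ)⁻¹) ^ n1 * ((Fintype.card J : ℝ)⁻¹) ^ (n2 - n1) ≤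
      Real.exp (-(((lG - lJ) / τ1 + lJ / τ2) / (1 + κ) * L)) := by
    have eG : (Fintype.card Γ : ℝ)⁻¹ = Real.exp (-lG) := by rw [Real.exp_neg, Real.exp_log hG]
    have eJ : (Fintype.card J : ℝ)⁻¹ = Real.exp (-lJ) := by rw [Real.exp_neg, Real.exp_log hJ]
    rw [eG, eJ, ← Real.exp_nat_mul, ← Real.exp_nat_mul, ← Real.exp_add, Real.exp_le_exp,
      Nat.cast_sub hn]
    have g1 := mul_le_mul_of_nonneg_left f1 hlGJ
    have g2 := mul_le_mul_of_nonneg_left f2 hlJ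
    have g3 : ((lG - lJ) / τ1 + lJ / τ2) / (1 + κ) * L =
        (lG - lJ) * (L / (τ1 * (1 + κ))) + lJ * (L / (τ2 * (1 + κ))) := by
      field_simp
    rw [g3]; linarith
  calc (S1.card : ℝ) * S2.card * (((Fintype.card Γ : ℝ)⁻¹) ^ n1 * ((Fintype.card J : ℝ)⁻¹) ^ (n2 - n1))
      ≤ (K1 * Real.exp (κ * L)) * (K2 * Real.exp (κ * L)) *
        Real.exp (-(((lG - lJ) / τ1 + lJ / τ2) / (1 + κ) * L)) := by gcongr
    _ = K1 * K2 * (Real.exp (κ * L) * Real.exp (κ * L) *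
        Real.exp (-(((lG - lJ) / τ1 + lJ / τ2) / (1 + κ) * L))) := by ring
    _ = _ := by
      rw [← Real.exp_add, ← Real.exp_add]; congr 2; ring

lemma cp_mdp (μ : Measure (ℝ × ℝ)) [IsProbabilityMeasure μ] (s K : ℝ) (hK : 0 < K)
    (h : ∀ L : ℝ, 0 ≤ L → ∀ x y : ℝ, μ {z | |z.1 - x| ≤ Real.exp (-L) ∧ |z.2 - y| ≤ Real.exp (-L)}
      ≤ ENNReal.ofReal (K * Real.exp (-(s * L)))) (E : Set (ℝ × ℝ)) (hE : μ E ≠ 0) :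
    ENNReal.ofReal s ≤ dimH E := by
  rcases le_or_gt s 0 with hs | hs
  · simp [ENNReal.ofReal_of_nonpos hs]
  set d : ℝ≥0 := Real.toNNReal s with hd
  have hds : (d : ℝ) = s := Real.coe_toNNReal _ hs.le
  change (d : ℝ≥0∞) ≤ dimH E
  apply le_dimH_of_hausdorffMeasure_ne_zero
  set c : ℝ≥0∞ := ENNReal.ofReal K with hc
  have hc0 : c ≠ 0 := by simp [hc, hK]
  have hct : c ≠ ⊤ := ENNReal.ofReal_ne_top
  have hle : c⁻¹ • μ ≤ Measure.hausdorffMeasure (d : ℝ) := by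
    refine Measure.le_hausdorffMeasure _ _ 1 one_pos fun A hA => ?_
    rw [Measure.smul_apply, smul_eq_mul, hds]
    rcases A.eq_empty_or_nonempty with rfl | ⟨z, hz⟩
    · simp
    have hsub : ∀ L : ℝ, Metric.ediam A ≤ ENNReal.ofReal (Real.exp (-L)) →
        A ⊆ {w | |w.1 - z.1| ≤ Real.exp (-L) ∧ |w.2 - z.2| ≤ Real.exp (-L)} := by
      intro L hL w hw
      have h1 : edist w z ≤ ENNReal.ofReal (Real.exp (-L)) :=
        (Metric.edist_le_ediam_of_mem hw hz).trans hL
      rw [edist_dist, ENNReal.ofReal_le_ofReal_iff (Real.exp_pos _).le, Prod.dist_eq,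
        max_le_iff, Real.dist_eq, Real.dist_eq] at h1
      exact h1
    by_cases h0 : Metric.ediam A = 0
    · have hz : μ A = 0 := by
        refine le_antisymm ?_ zero_le
        have ht : Tendsto (fun n : ℕ => ENNReal.ofReal (K * Real.exp (-(s * n)))) atTop
            (nhds (ENNReal.ofReal (K * 0))) := by
          apply ENNReal.tendsto_ofReal
          apply Tendsto.const_mul
          apply Real.tendsto_exp_neg_atTop_nhds_zero.comp
          exact tendsto_natCast_atTop_atTop.const_mul_atTop hs
        rw [mul_zero, ENNReal.ofReal_zero] at ht
        refine ge_of_tendsto' ht fun n => ?_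
        exact (measure_mono (hsub n (by rw [h0]; exact zero_le))).trans
          (h n (Nat.cast_nonneg n) z.1 z.2)
      simp [hz]
    · set δ := (Metric.ediam A).toReal with hδ
      have hAt : Metric.ediam A ≠ ⊤ := ne_top_of_le_ne_top ENNReal.one_ne_top hA
      have hδ0 : 0 < δ := ENNReal.toReal_pos h0 hAt
      have hδ1 : δ ≤ 1 := ENNReal.toReal_le_of_le_ofReal zero_le_one (by simpa using hA)
      have hAδ : Metric.ediam A = ENNReal.ofReal δ := (ENNReal.ofReal_toReal hAt).symm
      have hL : 0 ≤ -Real.log δ := by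
        have := Real.log_nonpos hδ0.le hδ1; linarith
      have h2 := (measure_mono (hsub (-Real.log δ) (by
        rw [neg_neg, Real.exp_log hδ0, hAδ]))).trans (h _ hL z.1 z.2)
      have h3 : Real.exp (-(s * -Real.log δ)) = δ ^ s := by
        rw [Real.rpow_def_of_pos hδ0]; congr 1; ring
      rw [h3, ENNReal.ofReal_mul hK.le] at h2
      rw [hAδ, ENNReal.ofReal_rpow_of_pos hδ0]
      calc c⁻¹ * μ A ≤ c⁻¹ * (c * ENNReal.ofReal (δ ^ s)) := by gcongr
        _ = _ := by rw [← mul_assoc, ENNReal.inv_mul_cancel hc0 hct, one_mul]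
  have h4 := hle E
  rw [Measure.smul_apply, smul_eq_mul] at h4
  intro h5
  rw [h5] at h4
  have := le_antisymm h4 zero_le
  rcases mul_eq_zero.1 this with h6 | h6
  · exact hct (ENNReal.inv_eq_zero.1 h6)
  · exact hE h6


def cpShift {Γ : Type} (ω : ℕ → Γ) : ℕ → Γ := fun k => ω (k + 1)

lemma cpShift_meas {Γ : Type} [MeasurableSpace Γ] : Measurable (cpShift (Γ := Γ)) :=
  measurable_pi_iff.2 fun k => measurable_pi_apply (k + 1)

lemma cpShift_iter {Γ : Type} (n : ℕ) : ∀ ω : ℕ → Γ, cpShift^[n] ω = fun k => ω (k + n) := by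
  induction n with
  | zero => intro ω; rfl
  | succ n ih =>
    intro ω
    rw [Function.iterate_succ_apply, ih]
    funext k
    simp only [cpShift]
    congr 1

lemma cpShift_mp {Γ : Type} [Fintype Γ] [Nonempty Γ] [MeasurableSpace Γ] :
    MeasurePreserving cpShift (cpBern Γ) (cpBern Γ) := by
  refine ⟨cpShift_meas, ?_⟩
  unfold cpBern
  apply Measure.eq_infinitePi
  intro s t ht
  rw [Measure.map_apply cpShift_meas (MeasurableSet.pi s.countable_toSet fun i _ => ht i)]
  have : cpShift ⁻¹' (Set.pi (s : Set ℕ) t) =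
      Set.pi ((s.image (· + 1) : Finset ℕ) : Set ℕ) (fun k => t (k - 1)) := by
    ext ω
    simp [Set.mem_pi, cpShift]
  rw [this, Measure.infinitePi_pi _ (fun i _ => ht _), Finset.prod_image (by simp)]
  simp

lemma cpBern_zero_one {Γ : Type} [Fintype Γ] [Nonempty Γ] [MeasurableSpace Γ]
    (E : Set (ℕ → Γ)) (hE : MeasurableSet E) (hinv : cpShift ⁻¹' E = E) :
    cpBern Γ E = 0 ∨ cpBern Γ E = 1 := by
  have hind : ProbabilityTheory.iIndepFun (fun (k : ℕ) (ω : ℕ → Γ) => ω k) (cpBern Γ) :=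
    ProbabilityTheory.iIndepFun_infinitePi (P := fun _ => (PMF.uniformOfFintype Γ).toMeasure)
      (X := fun _ x => x) (fun _ => measurable_id)
  have hind' : ProbabilityTheory.iIndep
    (fun k : ℕ => MeasurableSpace.comap (fun ω : ℕ → Γ => ω k) inferInstance) (cpBern Γ) := hind
  refine ProbabilityTheory.measure_zero_or_one_of_measurableSet_limsup_atTop ?_ hind' ?_
  · intro k
    exact (measurable_pi_apply k).comap_le
  · rw [Filter.limsup_eq_iInf_iSup_of_nat, MeasurableSpace.measurableSet_iInf]
    intro n
    have hn : cpShift^[n] ⁻¹' E = E := by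
      induction n with
      | zero => rfl
      | succ n ih => rw [Function.iterate_succ, Set.preimage_comp, ih, hinv]
    rw [← hn]
    have hm : @Measurable (ℕ → Γ) (ℕ → Γ) (⨆ i, ⨆ (_ : i ≥ n),
        MeasurableSpace.comap (fun ω : ℕ → Γ => ω i) inferInstance) _ (cpShift^[n]) := by
      refine @measurable_pi_lambda _ _ _ (_) _ _ fun k => ?_
      have : (fun ω : ℕ → Γ => cpShift^[n] ω k) = fun ω => ω (k + n) := by
        funext ω; rw [cpShift_iter]
      rw [this]
      have h1 : MeasurableSpace.comap (fun ω : ℕ → Γ => ω (k + n)) inferInstance ≤ ⨆ i,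
        ⨆ (_ : i ≥ n), MeasurableSpace.comap (fun ω : ℕ → Γ => ω i) inferInstance :=
        le_iSup₂_of_le (k + n) (by omega) le_rfl
      exact measurable_iff_comap_le.2 h1
    exact hm hE

lemma cp_avg {Ω Y : Type} [MeasurableSpace Ω] [MeasurableSpace Y] (P : Measure Ω)
    [IsProbabilityMeasure P] (S : Ω → Ω) (hS : MeasurePreserving S P P)
    (h01 : ∀ E, MeasurableSet E → S ⁻¹' E = E → P E = 0 ∨ P E = 1)
    (T : Y → Y) (hT : Measurable T) (θ : Ω → Y) (hθ : Measurable θ) (M : ℕ) (hM : 0 < M)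
    (hc : ∀ ω, T^[M] (θ ω) = θ (S ω)) :
    ∃ ν : Measure Y, IsProbabilityMeasure ν ∧ Ergodic T ν ∧
      ∀ E, MeasurableSet E → ν E = 1 → P (θ ⁻¹' E) = 1 := by
  set ν : Measure Y := (M : ℝ≥0∞)⁻¹ • ∑ k ∈ Finset.range M, P.map (T^[k] ∘ θ) with hν
  have hM0 : (M : ℝ≥0∞) ≠ 0 := by exact_mod_cast hM.ne'
  have hMt : (M : ℝ≥0∞) ≠ ⊤ := ENNReal.natCast_ne_top M
  have hmeas : ∀ k, Measurable (T^[k] ∘ θ) := fun k => (hT.iterate k).comp hθ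
  have hap : ∀ E, MeasurableSet E → ν E =
      (M : ℝ≥0∞)⁻¹ * ∑ k ∈ Finset.range M, P ((T^[k] ∘ θ) ⁻¹' E) := by
    intro E hE
    rw [hν, Measure.smul_apply, Measure.finsetSum_apply, smul_eq_mul]
    congr 1
    exact Finset.sum_congr rfl fun k _ => Measure.map_apply (hmeas k) hE
  have hprob : IsProbabilityMeasure ν := by
    constructor
    rw [hap _ MeasurableSet.univ]
    simp [ENNReal.inv_mul_cancel hM0 hMt]
  refine ⟨ν, hprob, ?_, ?_⟩
  · refine { measurable := hT, map_eq := ?_, aeconst_set := ?_ }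
    · ext E hE
      rw [Measure.map_apply hT hE, hap _ (hT hE), hap _ hE]
      congr 1
      set c : ℕ → ℝ≥0∞ := fun k => P ((T^[k] ∘ θ) ⁻¹' E) with hcdef
      have h1 : ∀ k, P ((T^[k] ∘ θ) ⁻¹' (T ⁻¹' E)) = c (k + 1) := by
        intro k
        simp only [hcdef, Function.iterate_succ', Set.preimage_comp]
      simp only [h1]
      change _ = ∑ k ∈ Finset.range M, c k
      have h2 : c M = c 0 := by
        have : T^[M] ∘ θ = θ ∘ S := funext hc
        change P ((T^[M] ∘ θ) ⁻¹' E) = P (θ ⁻¹' E)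
        rw [this]
        exact hS.measure_preimage (hθ hE).nullMeasurableSet
      have h3 := (Finset.sum_range_succ c M).symm.trans (Finset.sum_range_succ' c M)
      rw [h2] at h3
      exact ((ENNReal.add_left_inj (measure_ne_top P _)).1 h3).symm
    · intro E hE hinv
      have hk : ∀ k, T^[k] ⁻¹' E = E := by
        intro k
        induction k with
        | zero => rfl
        | succ k ih => rw [Function.iterate_succ, Set.preimage_comp, ih, hinv]
      have h1 : ν E = P (θ ⁻¹' E) := by
        rw [hap E hE]
        simp only [Set.preimage_comp, hk]
        rw [Finset.sum_const, Finset.card_range, nsmul_eq_mul, ← mul_assoc,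
          ENNReal.inv_mul_cancel hM0 hMt, one_mul]
      have h2 : S ⁻¹' (θ ⁻¹' E) = θ ⁻¹' E := by
        rw [← Set.preimage_comp]
        have : θ ∘ S = T^[M] ∘ θ := (funext hc).symm
        rw [this, Set.preimage_comp, hk]
      rw [Filter.eventuallyConst_set']
      rcases h01 _ (hθ hE) h2 with h | h
      · left; rw [ae_eq_empty, h1, h]
      · right; rw [ae_eq_univ, prob_compl_eq_zero_iff hE, h1, h]
  · intro E hE h1
    rw [← prob_compl_eq_zero_iff hE, hap _ hE.compl, mul_eq_zero] at h1
    rcases h1 with h1 | h1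
    · exact absurd (ENNReal.inv_eq_zero.1 h1) hMt
    · have := Finset.sum_eq_zero_iff.1 h1 0 (Finset.mem_range.2 hM)
      rw [← prob_compl_eq_zero_iff (hθ hE)]
      exact this


open Classical in
lemma cp_tball {B I J : Type} [Fintype B] [Fintype J] [Fintype I]
    (p : B → I) (q : B → J) (hinj : Function.Injective fun b => (p b, q b))
    (C : CS I) (D : CS J) (a : I → ℝ) (b : J → ℝ) (ha : ∀ i, 0 < a i) (hb : ∀ j, 0 < b j)
    {κ : ℝ} (hκ : 0 < κ) (hCu : C.Up a) (hCl : C.Lo fun i => (1 + κ) * a i)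
    (hDu : D.Up b) (hDl : D.Lo fun i => (1 + κ) * b i)
    {m : ℕ} (hm : 0 < m) (u : Fin m → B) (hab : ∑ i, b (q (u i)) ≤ ∑ i, a (p (u i)))
    [Nonempty {w : Fin m → B // cpTyp w = cpTyp u}]
    [MeasurableSpace {w : Fin m → B // cpTyp w = cpTyp u}]
    [DiscreteMeasurableSpace {w : Fin m → B // cpTyp w = cpTyp u}] :
    ∃ K : ℝ, 0 < K ∧ ∀ L : ℝ, 0 ≤ L → ∀ x y : ℝ,
      cpBern {w : Fin m → B // cpTyp w = cpTyp u}
        {ω | |C.Φ (p ∘ cpCat hm (Subtype.val ∘ ω)) - x| ≤ Real.exp (-L) ∧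
          |D.Φ (q ∘ cpCat hm (Subtype.val ∘ ω)) - y| ≤ Real.exp (-L)} ≤
        ENNReal.ofReal (K * Real.exp (-((((Real.log (cpTc u) - Real.log (cpTc (q ∘ u))) /
          (∑ i, a (p (u i))) + Real.log (cpTc (q ∘ u)) / (∑ i, b (q (u i)))) / (1 + κ) - 2 * κ) * L))) := by
  have hty : ∀ {Z : Type} (q : B → Z) (w : Fin m → B), cpTyp w = cpTyp u →
      cpTyp (q ∘ w) = cpTyp (q ∘ u) := fun q w hw => by
    obtain ⟨σ, rfl⟩ := cpTyp_exists_perm hw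
    exact cpTyp_perm (q ∘ u) σ
  have hsum : ∀ {Z : Type} (c : Z → ℝ) (v w : Fin m → Z), cpTyp w = cpTyp v →
      ∑ i, c (w i) = ∑ i, c (v i) := fun c v w hw => by
    obtain ⟨σ, rfl⟩ := cpTyp_exists_perm hw
    exact Equiv.sum_comp σ fun i => c (v i)
  set p' : {w : Fin m → B // cpTyp w = cpTyp u} → {w : Fin m → I // cpTyp w = cpTyp (p ∘ u)} :=
    fun w => ⟨p ∘ w.1, hty p _ w.2⟩ with hp'
  set q' : {w : Fin m → B // cpTyp w = cpTyp u} → {w : Fin m → J // cpTyp w = cpTyp (q ∘ u)} :=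
    fun w => ⟨q ∘ w.1, hty q _ w.2⟩ with hq'
  set C' : CS {w : Fin m → I // cpTyp w = cpTyp (p ∘ u)} :=
    (C.block hm).comap Subtype.val Subtype.val_injective with hC'
  set D' : CS {w : Fin m → J // cpTyp w = cpTyp (q ∘ u)} :=
    (D.block hm).comap Subtype.val Subtype.val_injective with hD'
  have c1 : Fintype.card {w : Fin m → B // cpTyp w = cpTyp u} = cpTc u := by
    rw [Fintype.card_subtype, cpTc]
  have c2 : Fintype.card {w : Fin m → J // cpTyp w = cpTyp (q ∘ u)} = cpTc (q ∘ u) := by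
    rw [Fintype.card_subtype, cpTc]
  haveI : Nonempty (Fin m) := ⟨⟨0, hm⟩⟩
  have hτ2 : 0 < ∑ i, b (q (u i)) := Finset.sum_pos (fun i _ => hb _) Finset.univ_nonempty
  have hinj' : Function.Injective fun γ => (p' γ, q' γ) := by
    intro w w' h
    simp only [hp', hq', Prod.mk.injEq, Subtype.mk.injEq] at h
    apply Subtype.ext
    funext k
    exact hinj (Prod.ext (congrFun h.1 k) (congrFun h.2 k))
  have hfib : ∀ j, (Finset.univ.filter fun γ => q' γ = j).card *
      Fintype.card {w : Fin m → J // cpTyp w = cpTyp (q ∘ u)} =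
      Fintype.card {w : Fin m → B // cpTyp w = cpTyp u} := by
    intro j
    rw [c1, c2, ← cpTc_fiber q u j.1 j.2]
    congr 1
    rw [← Finset.card_map (Function.Embedding.subtype _)]
    congr 1
    ext w
    simp only [Finset.mem_map, Finset.mem_filter, Finset.mem_univ, true_and,
      Function.Embedding.subtype_apply]
    constructor
    · rintro ⟨γ, h1, rfl⟩
      exact ⟨γ.2, congrArg Subtype.val h1⟩
    · rintro ⟨h1, h2⟩
      exact ⟨⟨w, h1⟩, Subtype.ext h2, rfl⟩
  have e1 : C'.Up fun _ => ∑ i, a (p (u i)) := by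
    intro w x hx y hy
    have := C.block_up hm hCu w.1 x hx y hy
    beta_reduce at this
    rw [hsum a (p ∘ u) w.1 w.2] at this
    exact this
  have e2 : C'.Lo fun _ => (1 + κ) * ∑ i, a (p (u i)) := by
    intro w x hx y hy
    have := C.block_lo hm hCl w.1 x hx y hy
    beta_reduce at this
    rw [← Finset.mul_sum, hsum a (p ∘ u) w.1 w.2] at this
    exact this
  have e3 : D'.Up fun _ => ∑ i, b (q (u i)) := by
    intro w x hx y hy
    have := D.block_up hm hDu w.1 x hx y hy
    beta_reduce at this
    rw [hsum b (q ∘ u) w.1 w.2] at this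
    exact this
  have e4 : D'.Lo fun _ => (1 + κ) * ∑ i, b (q (u i)) := by
    intro w x hx y hy
    have := D.block_lo hm hDl w.1 x hx y hy
    beta_reduce at this
    rw [← Finset.mul_sum, hsum b (q ∘ u) w.1 w.2] at this
    exact this
  obtain ⟨K, hK, h⟩ := cp_ball p' q' hinj' (fun j => by convert hfib j) C' D' hτ2 hab hκ e1 e2 e3 e4
  rw [c1, c2] at h
  exact ⟨K, hK, h⟩

lemma np_fold {Λ₁ Λ₂ : Type} (F : ConformalIFS Λ₁) (G : ConformalIFS Λ₂)
    (l : List (Λ₁ × Λ₂)) (z : ℝ × ℝ) :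
    (l.foldr (fun ij h => carpetMap F G ij ∘ h) id) z =
      (compWord F.f (l.map Prod.fst) z.1, compWord G.f (l.map Prod.snd) z.2) := by
  induction l with
  | nil => simp [compWord]
  | cons i l ih => simp [compWord, ih, carpetMap]

lemma np_eq {Λ₁ Λ₂ : Type} (F : ConformalIFS Λ₁) (G : ConformalIFS Λ₂) (C : CS Λ₁) (D : CS Λ₂)
    (hC : ∀ ω : ℕ → Λ₁,
      Tendsto (fun n => compWord F.f ((List.range n).map ω) 0) atTop (nhds (C.Φ ω)))
    (hD : ∀ ω : ℕ → Λ₂,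
      Tendsto (fun n => compWord G.f ((List.range n).map ω) 0) atTop (nhds (D.Φ ω)))
    (ω : ℕ → Λ₁ × Λ₂) :
    Tendsto (fun n => (((List.range n).map ω).foldr (fun ij h => carpetMap F G ij ∘ h) id) (0, 0))
      atTop (nhds (C.Φ (Prod.fst ∘ ω), D.Φ (Prod.snd ∘ ω))) ∧
    natProj F G ω = (C.Φ (Prod.fst ∘ ω), D.Φ (Prod.snd ∘ ω)) := by
  have h : Tendsto (fun n => (((List.range n).map ω).foldr
      (fun ij h => carpetMap F G ij ∘ h) id) (0, 0))
      atTop (nhds (C.Φ (Prod.fst ∘ ω), D.Φ (Prod.snd ∘ ω))) := by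
    simp only [np_fold, List.map_map]
    exact (hC _).prodMk_nhds (hD _)
  exact ⟨h, h.limUnder_eq⟩

lemma np_meas {Λ₁ Λ₂ : Type} (F : ConformalIFS Λ₁) (G : ConformalIFS Λ₂)
    (C : CS Λ₁) (D : CS Λ₂)
    (hC : ∀ ω : ℕ → Λ₁,
      Tendsto (fun n => compWord F.f ((List.range n).map ω) 0) atTop (nhds (C.Φ ω)))
    (hD : ∀ ω : ℕ → Λ₂,
      Tendsto (fun n => compWord G.f ((List.range n).map ω) 0) atTop (nhds (D.Φ ω)))
    (A : Set (Λ₁ × Λ₂)) [Finite A] [MeasurableSpace A] [DiscreteMeasurableSpace A] :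
    Measurable fun ω : ℕ → A => natProj F G fun k => (ω k : Λ₁ × Λ₂) := by
  refine measurable_of_tendsto_metrizable (f := fun n (ω : ℕ → A) =>
    (((List.range n).map fun k => (ω k : Λ₁ × Λ₂)).foldr
      (fun ij h => carpetMap F G ij ∘ h) id) (0, 0)) (fun n => ?_) (tendsto_pi_nhds.2 fun ω => ?_)
  · have : (fun ω : ℕ → A => (((List.range n).map fun k => (ω k : Λ₁ × Λ₂)).foldr
        (fun ij h => carpetMap F G ij ∘ h) id) ((0:ℝ), (0:ℝ))) =
        (fun v : Fin n → A => ((List.ofFn fun k => (v k : Λ₁ × Λ₂)).foldr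
          (fun ij h => carpetMap F G ij ∘ h) id) ((0:ℝ), (0:ℝ))) ∘ fun ω k => ω k := by
      funext ω
      simp only [Function.comp_apply]
      have hl : ((List.range n).map fun k => (ω k : Λ₁ × Λ₂)) =
          List.ofFn fun k : Fin n => (ω k : Λ₁ × Λ₂) := by
        apply List.ext_getElem <;> simp
      rw [hl]
    rw [this]
    refine Measurable.comp (measurable_of_countable _) ?_
    exact measurable_pi_iff.2 fun k => measurable_pi_apply _
  · have h := np_eq F G C D hC hD fun k => (ω k : Λ₁ × Λ₂)
    rw [h.2]
    exact h.1

lemma np_mem {Λ₁ Λ₂ : Type} (F : ConformalIFS Λ₁) (G : ConformalIFS Λ₂)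
    (C : CS Λ₁) (D : CS Λ₂) (hCF : C.h = F.f) (hDG : D.h = G.f)
    (hC : ∀ ω : ℕ → Λ₁,
      Tendsto (fun n => compWord F.f ((List.range n).map ω) 0) atTop (nhds (C.Φ ω)))
    (hD : ∀ ω : ℕ → Λ₂,
      Tendsto (fun n => compWord G.f ((List.range n).map ω) 0) atTop (nhds (D.Φ ω)))
    (A : Set (Λ₁ × Λ₂)) (X : Set (ℝ × ℝ)) (hX : IsCarpetAttractor F G A X) :
    X = Set.range fun ω : ℕ → A => (C.Φ fun k => (ω k).1.1, D.Φ fun k => (ω k).1.2) := by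
  obtain ⟨⟨z0, hz0⟩, hXc, hXs, hXe⟩ := hX
  have hstep : ∀ ij ∈ A, ∀ z ∈ X, carpetMap F G ij z ∈ X := by
    intro ij hij z hz
    rw [hXe]
    exact Set.mem_biUnion hij ⟨z, hz, rfl⟩
  -- compWord iterates of `x` and the coding point are close
  have hF : ∀ (ω : ℕ → Λ₁) (x : ℝ), x ∈ Icc (0:ℝ) 1 → Tendsto (fun n =>
      compWord F.f ((List.range n).map ω) x) atTop (nhds (C.Φ ω)) := by
    intro ω x hx
    refine (hC ω).congr_dist ?_
    refine squeeze_zero (fun _ => dist_nonneg) (fun n => ?_)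
      (tendsto_pow_atTop_nhds_zero_of_lt_one F.ratio_pos.le F.ratio_lt_one)
    rw [Real.dist_eq]
    have := cf_contr F ((List.range n).map ω) 0 (by simp) x hx
    simp only [List.length_map, List.length_range] at this
    exact this.trans (mul_le_of_le_one_right (pow_nonneg F.ratio_pos.le _)
      (cp_abs01 (by simp) hx))
  have hG : ∀ (ω : ℕ → Λ₂) (x : ℝ), x ∈ Icc (0:ℝ) 1 → Tendsto (fun n =>
      compWord G.f ((List.range n).map ω) x) atTop (nhds (D.Φ ω)) := by
    intro ω x hx
    refine (hD ω).congr_dist ?_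
    refine squeeze_zero (fun _ => dist_nonneg) (fun n => ?_)
      (tendsto_pow_atTop_nhds_zero_of_lt_one G.ratio_pos.le G.ratio_lt_one)
    rw [Real.dist_eq]
    have := cf_contr G ((List.range n).map ω) 0 (by simp) x hx
    simp only [List.length_map, List.length_range] at this
    exact this.trans (mul_le_of_le_one_right (pow_nonneg G.ratio_pos.le _)
      (cp_abs01 (by simp) hx))
  apply Set.Subset.antisymm
  · intro z hz
    have hch : ∀ z : X, ∃ (i : A) (z' : X), carpetMap F G i z' = z := by
      rintro ⟨z, hz⟩
      rw [hXe] at hz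
      obtain ⟨ij, hij, z', hz', h⟩ := Set.mem_iUnion₂.1 hz
      exact ⟨⟨ij, hij⟩, ⟨z', hz'⟩, h⟩
    choose i nx hnx using hch
    set Z : ℕ → X := fun n => nx^[n] ⟨z, hz⟩ with hZ
    refine ⟨fun k => i (Z k), ?_⟩
    have key : ∀ n, compWord F.f ((List.range n).map fun k => (i (Z k)).1.1) (Z n).1.1 = z.1 ∧
        compWord G.f ((List.range n).map fun k => (i (Z k)).1.2) (Z n).1.2 = z.2 := by
      intro n
      induction n with
      | zero => simp [compWord, hZ]
      | succ n ih =>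
        have h1 : carpetMap F G (i (Z n)) (Z (n + 1)) = (Z n : ℝ × ℝ) := by
          have := hnx (Z n)
          simp only [hZ, Function.iterate_succ_apply'] at this ⊢
          exact this
        rw [List.range_succ, List.map_append, List.map_append, cw_append, cw_append]
        have h2 := congrArg Prod.fst h1
        have h3 := congrArg Prod.snd h1
        simp only [carpetMap] at h2 h3
        simp only [List.map_cons, List.map_nil, compWord, Function.comp_apply, id]
        rw [h2, h3]; exact ih
    have hbd : ∀ n, (Z n).1.1 ∈ Icc (0:ℝ) 1 ∧ (Z n).1.2 ∈ Icc (0:ℝ) 1 := fun n => hXs (Z n).2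
    refine Prod.ext ?_ ?_
    · refine tendsto_nhds_unique (hC fun k => (i (Z k)).1.1) ?_
      rw [tendsto_iff_dist_tendsto_zero]
      refine squeeze_zero (fun _ => dist_nonneg) (fun n => ?_)
        (tendsto_pow_atTop_nhds_zero_of_lt_one F.ratio_pos.le F.ratio_lt_one)
      have := cf_contr F ((List.range n).map fun k => (i (Z k)).1.1) 0 (by simp) _ (hbd n).1
      simp only [List.length_map, List.length_range] at this
      rw [(key n).1] at this
      exact this.trans (mul_le_of_le_one_right (pow_nonneg F.ratio_pos.le _)
        (cp_abs01 (by simp) (hbd n).1))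
    · refine tendsto_nhds_unique (hD fun k => (i (Z k)).1.2) ?_
      rw [tendsto_iff_dist_tendsto_zero]
      refine squeeze_zero (fun _ => dist_nonneg) (fun n => ?_)
        (tendsto_pow_atTop_nhds_zero_of_lt_one G.ratio_pos.le G.ratio_lt_one)
      have := cf_contr G ((List.range n).map fun k => (i (Z k)).1.2) 0 (by simp) _ (hbd n).2
      simp only [List.length_map, List.length_range] at this
      rw [(key n).2] at this
      exact this.trans (mul_le_of_le_one_right (pow_nonneg G.ratio_pos.le _)
        (cp_abs01 (by simp) (hbd n).2))
  · rintro _ ⟨ω, rfl⟩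
    have hz := hXs hz0
    refine hXc.isClosed.mem_of_tendsto
      ((hF (fun k => (ω k).1.1) z0.1 hz.1).prodMk_nhds (hG (fun k => (ω k).1.2) z0.2 hz.2))
      (Eventually.of_forall fun n => ?_)
    have : ∀ l : List A, (compWord F.f (l.map fun k => k.1.1) z0.1,
        compWord G.f (l.map fun k => k.1.2) z0.2) ∈ X := by
      intro l
      induction l with
      | nil => simpa [compWord] using hz0
      | cons j l ih => exact hstep j.1 j.2 _ ih
    have h2 := this ((List.range n).map ω)
    simpa [List.map_map, Function.comp_def] using h2


lemma cpCat_add_mul {I : Type} {N : ℕ} (hN : 0 < N) (m : ℕ) :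
    ∀ (ω : ℕ → Fin N → I) (k : ℕ),
      cpCat hN ω (k + N * m) = cpCat hN (fun j => ω (j + m)) k := by
  induction m with
  | zero => intro ω k; rfl
  | succ m ih =>
    intro ω k
    have : k + N * (m + 1) = (k + N * m) + N := by ring
    rw [this, cpCat_add, ih]
    congr 1

lemma cp_erg {Λ₁ Λ₂ : Type} [Fintype Λ₁] [Fintype Λ₂]
    (F : ConformalIFS Λ₁) (G : ConformalIFS Λ₂) (C : CS Λ₁) (D : CS Λ₂)
    (hC : ∀ ω : ℕ → Λ₁,
      Tendsto (fun n => compWord F.f ((List.range n).map ω) 0) atTop (nhds (C.Φ ω)))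
    (hD : ∀ ω : ℕ → Λ₂,
      Tendsto (fun n => compWord G.f ((List.range n).map ω) 0) atTop (nhds (D.Φ ω)))
    (A : Set (Λ₁ × Λ₂)) {N m : ℕ} (hN : 0 < N) (hm : 0 < m)
    (Γ : Type) [Fintype Γ] [Nonempty Γ] [MeasurableSpace Γ] [DiscreteMeasurableSpace Γ]
    (v : Γ → Fin m → Fin N → A) (s K : ℝ) (hK : 0 < K)
    (h : ∀ L : ℝ, 0 ≤ L → ∀ x y : ℝ, cpBern Γ
      {ω | |(C.block hN).Φ ((fun w k => (w k).1.1) ∘ cpCat hm (v ∘ ω)) - x| ≤ Real.exp (-L) ∧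
        |(D.block hN).Φ ((fun w k => (w k).1.2) ∘ cpCat hm (v ∘ ω)) - y| ≤ Real.exp (-L)} ≤
      ENNReal.ofReal (K * Real.exp (-(s * L)))) :
    ∃ μ : Measure (ℝ × ℝ), IsErgodicCarpetMeasure F G A μ ∧ ENNReal.ofReal s ≤ dimHMeasure μ := by
  letI : MeasurableSpace A := ⊤
  have hπ : Measurable fun ω : ℕ → A => natProj F G fun k => (ω k : Λ₁ × Λ₂) :=
    np_meas F G C D hC hD A
  set θ : (ℕ → Γ) → ℕ → A := fun ω => cpCat hN (cpCat hm (v ∘ ω)) with hθd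
  have hθ : Measurable θ := by
    refine measurable_pi_iff.2 fun k => ?_
    have : (fun ω => θ ω k) = (fun γ : Γ => v γ ⟨k / N % m, Nat.mod_lt _ hm⟩
        ⟨k % N, Nat.mod_lt _ hN⟩) ∘ fun ω : ℕ → Γ => ω (k / N / m) := rfl
    rw [this]
    exact (Measurable.of_discrete).comp (measurable_pi_apply _)
  have hc : ∀ ω, cpShift^[N * m] (θ ω) = θ (cpShift ω) := by
    intro ω
    rw [cpShift_iter]
    funext k
    simp only [hθd]
    rw [cpCat_add_mul]
    congr 1
    funext j
    rw [cpCat_add]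
    rfl
  obtain ⟨ν, hν, hνe, hν1⟩ := cp_avg (cpBern Γ) cpShift cpShift_mp cpBern_zero_one
    (cpShift (Γ := A)) cpShift_meas θ hθ (N * m) (Nat.mul_pos hN hm) hc
  refine ⟨ν.map fun ω => natProj F G fun k => (ω k : Λ₁ × Λ₂), ⟨ν, hν, hνe, rfl⟩, ?_⟩
  refine le_sInf ?_
  rintro _ ⟨E, hE, hE1, rfl⟩
  rw [Measure.map_apply hπ hE] at hE1
  have h1 := hν1 _ (hπ hE) hE1
  have hπθ := hπ.comp hθ
  haveI : IsProbabilityMeasure ((cpBern Γ).map ((fun ω : ℕ → A =>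
      natProj F G fun k => (ω k : Λ₁ × Λ₂)) ∘ θ)) :=
    Measure.isProbabilityMeasure_map hπθ.aemeasurable
  refine cp_mdp ((cpBern Γ).map ((fun ω : ℕ → A =>
      natProj F G fun k => (ω k : Λ₁ × Λ₂)) ∘ θ)) s K hK ?_ E ?_
  · intro L hL x y
    have hms : MeasurableSet {z : ℝ × ℝ | |z.1 - x| ≤ Real.exp (-L) ∧ |z.2 - y| ≤ Real.exp (-L)} := by
      refine MeasurableSet.inter ?_ ?_
      · exact measurableSet_le (f := fun z : ℝ × ℝ => |z.1 - x|) (by fun_prop) measurable_const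
      · exact measurableSet_le (f := fun z : ℝ × ℝ => |z.2 - y|) (by fun_prop) measurable_const
    rw [Measure.map_apply hπθ hms]
    refine le_trans (measure_mono ?_) (h L hL x y)
    intro ω hω
    have h2 := (np_eq F G C D hC hD fun k => (θ ω k : Λ₁ × Λ₂)).2
    have hω' : |(natProj F G fun k => (θ ω k : Λ₁ × Λ₂)).1 - x| ≤ Real.exp (-L) ∧
        |(natProj F G fun k => (θ ω k : Λ₁ × Λ₂)).2 - y| ≤ Real.exp (-L) := hω
    rw [h2] at hω'
    exact hω'
  · rw [Measure.map_apply hπθ hE]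
    rw [Set.preimage_comp, h1]
    exact one_ne_zero

lemma cp_dim2 (X : Set (ℝ × ℝ)) : dimH X ≤ 2 := by
  refine (dimH_mono (Set.subset_univ X)).trans ?_
  rw [Real.dimH_univ_eq_finrank (ℝ × ℝ)]
  simp

lemma cp_first {Λ₁ Λ₂ : Type} [Fintype Λ₁] [Fintype Λ₂]
    (F : ConformalIFS Λ₁) (G : ConformalIFS Λ₂) (C : CS Λ₁) (D : CS Λ₂)
    (hCF : C.h = F.f) (hDG : D.h = G.f)
    (hC : ∀ ω : ℕ → Λ₁,
      Tendsto (fun n => compWord F.f ((List.range n).map ω) 0) atTop (nhds (C.Φ ω)))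
    (hD : ∀ ω : ℕ → Λ₂,
      Tendsto (fun n => compWord G.f ((List.range n).map ω) 0) atTop (nhds (D.Φ ω)))
    (A : Set (Λ₁ × Λ₂)) (X : Set (ℝ × ℝ)) (hX : IsCarpetAttractor F G A X)
    (μ : Measure (ℝ × ℝ)) (hμ : IsErgodicCarpetMeasure F G A μ) : dimHMeasure μ ≤ dimH X := by
  letI : MeasurableSpace A := ⊤
  obtain ⟨ν, hν, -, rfl⟩ := hμ
  have hπ : Measurable fun ω : ℕ → A => natProj F G fun k => (ω k : Λ₁ × Λ₂) :=
    np_meas F G C D hC hD A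
  have hXm : MeasurableSet X := hX.2.1.isClosed.measurableSet
  refine sInf_le ⟨X, hXm, ?_, rfl⟩
  rw [Measure.map_apply hπ hXm]
  have : (fun ω : ℕ → A => natProj F G fun k => (ω k : Λ₁ × Λ₂)) ⁻¹' X = Set.univ := by
    refine Set.eq_univ_of_forall fun ω => ?_
    rw [Set.mem_preimage, (np_eq F G C D hC hD fun k => (ω k : Λ₁ × Λ₂)).2,
      np_mem F G C D hCF hDG hC hD A X hX]
    exact ⟨ω, rfl⟩
  rw [this]
  exact measure_univ

lemma cp_tball_gen {B I J : Type} [Fintype B] [Fintype J] [Fintype I]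
    [dB : DecidableEq B] [dJ : DecidableEq J]
    (p : B → I) (q : B → J) (hinj : Function.Injective fun b => (p b, q b))
    (C : CS I) (D : CS J) (a : I → ℝ) (b : J → ℝ) (ha : ∀ i, 0 < a i) (hb : ∀ j, 0 < b j)
    {κ : ℝ} (hκ : 0 < κ) (hCu : C.Up a) (hCl : C.Lo fun i => (1 + κ) * a i)
    (hDu : D.Up b) (hDl : D.Lo fun i => (1 + κ) * b i)
    {m : ℕ} (hm : 0 < m) (u : Fin m → B) (hab : ∑ i, b (q (u i)) ≤ ∑ i, a (p (u i)))
    [Fintype {w : Fin m → B // cpTyp w = cpTyp u}]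
    [Nonempty {w : Fin m → B // cpTyp w = cpTyp u}]
    [MeasurableSpace {w : Fin m → B // cpTyp w = cpTyp u}]
    [DiscreteMeasurableSpace {w : Fin m → B // cpTyp w = cpTyp u}] :
    ∃ K : ℝ, 0 < K ∧ ∀ L : ℝ, 0 ≤ L → ∀ x y : ℝ,
      cpBern {w : Fin m → B // cpTyp w = cpTyp u}
        {ω | |C.Φ (p ∘ cpCat hm (Subtype.val ∘ ω)) - x| ≤ Real.exp (-L) ∧
          |D.Φ (q ∘ cpCat hm (Subtype.val ∘ ω)) - y| ≤ Real.exp (-L)} ≤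
        ENNReal.ofReal (K * Real.exp (-((((Real.log (cpTc u) - Real.log (cpTc (q ∘ u))) /
          (∑ i, a (p (u i))) + Real.log (cpTc (q ∘ u)) / (∑ i, b (q (u i)))) / (1 + κ) - 2 * κ) * L))) := by
  obtain rfl : dB = fun a b => Classical.propDecidable (a = b) := Subsingleton.elim _ _
  obtain rfl : dJ = fun a b => Classical.propDecidable (a = b) := Subsingleton.elim _ _
  convert cp_tball p q hinj C D a b ha hb hκ hCu hCl hDu hDl hm u hab

open Classical in
lemma cp_second {Λ₁ Λ₂ : Type} [Fintype Λ₁] [Fintype Λ₂]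
    (F : ConformalIFS Λ₁) (G : ConformalIFS Λ₂) (C : CS Λ₁) (D : CS Λ₂)
    (hCF : C.h = F.f) (hDG : D.h = G.f)
    (hC : ∀ ω : ℕ → Λ₁,
      Tendsto (fun n => compWord F.f ((List.range n).map ω) 0) atTop (nhds (C.Φ ω)))
    (hD : ∀ ω : ℕ → Λ₂,
      Tendsto (fun n => compWord G.f ((List.range n).map ω) 0) atTop (nhds (D.Φ ω)))
    (A : Set (Λ₁ × Λ₂)) (hA : A.Nonempty) (X : Set (ℝ × ℝ)) (hX : IsCarpetAttractor F G A X)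
    (ε : ℝ) (hε : 0 < ε) :
    ∃ μ : Measure (ℝ × ℝ), IsErgodicCarpetMeasure F G A μ ∧
      dimH X - ENNReal.ofReal ε ≤ dimHMeasure μ := by
  have h2 := cp_dim2 X
  have hfin : dimH X ≠ ⊤ := ne_top_of_le_ne_top (by norm_num) h2
  set δ := (dimH X).toReal with hδ
  have hδX : dimH X = ENNReal.ofReal δ := (ENNReal.ofReal_toReal hfin).symm
  have hδ2 : δ ≤ 2 := by
    have := ENNReal.toReal_mono (by norm_num) h2
    simpa using this
  -- reduction to a real exponent
  suffices hs : ∃ s : ℝ, δ - ε ≤ s ∧ ∃ μ : Measure (ℝ × ℝ), IsErgodicCarpetMeasure F G A μ ∧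
      ENNReal.ofReal s ≤ dimHMeasure μ by
    obtain ⟨s, hs, μ, hμ, hsμ⟩ := hs
    refine ⟨μ, hμ, le_trans ?_ hsμ⟩
    rw [hδX, ← ENNReal.ofReal_sub _ hε.le]
    exact ENNReal.ofReal_le_ofReal hs
  rcases le_or_gt (δ - ε) 0 with h0 | h0
  · refine ⟨0, h0, ?_⟩
    obtain ⟨α, hα⟩ := hA
    refine cp_erg F G C D hC hD A one_pos one_pos Unit (fun _ _ _ => ⟨α, hα⟩) 0 1 one_pos ?_
    intro L hL x y
    refine prob_le_one.trans ?_
    simp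
  set κ := ε / 8 with hκd
  have hκ : 0 < κ := by positivity
  obtain ⟨N1, h1⟩ := cs_dist F C hCF κ hκ
  obtain ⟨N2, h2'⟩ := cs_dist G D hDG κ hκ
  set N := max (max N1 N2) 1 with hNd
  have hN : 0 < N := by omega
  obtain ⟨a, ha, haU, haL⟩ := h1 N (by omega) hN
  obtain ⟨b, hb, hbU, hbL⟩ := h2' N (by omega) hN
  set p : (Fin N → A) → Fin N → Λ₁ := fun w k => (w k).1.1 with hp
  set q : (Fin N → A) → Fin N → Λ₂ := fun w k => (w k).1.2 with hq
  have hinj : Function.Injective fun w => (p w, q w) := by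
    intro w w' h
    rw [Prod.mk.injEq] at h
    funext k
    exact Subtype.ext (Prod.ext (congrFun h.1 k) (congrFun h.2 k))
  have hinj' : Function.Injective fun w => (q w, p w) := by
    intro w w' h
    rw [Prod.mk.injEq] at h
    exact hinj (Prod.ext h.2 h.1)
  set d := δ - ε / 2 with hd
  have hd0 : 0 < d := by linarith
  have hκs : ∀ D : ℝ, d ≤ D → δ - ε ≤ D / (1 + κ) - 2 * κ := by
    intro D hD
    have : d - 2 * κ ≤ D / (1 + κ) := by
      rw [le_div_iff₀ (by linarith)]
      have : d ≤ 2 := by linarith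
      nlinarith
    linarith
  have hXr : X ⊆ Set.range (fun ω : ℕ → Fin N → A =>
      ((C.block hN).Φ (p ∘ ω), (D.block hN).Φ (q ∘ ω))) := by
    rw [np_mem F G C D hCF hDG hC hD A X hX]
    rintro _ ⟨ω, rfl⟩
    refine ⟨fun k j => ω (N * k + j), ?_⟩
    have e1 : (C.block hN).Φ (p ∘ fun k j => ω (N * k + j)) =
      C.Φ (fun k => (ω k).1.1) := congrArg C.Φ (cpCat_surj hN fun k => (ω k).1.1)
    have e2 : (D.block hN).Φ (q ∘ fun k j => ω (N * k + j)) =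
      D.Φ (fun k => (ω k).1.2) := congrArg D.Φ (cpCat_surj hN fun k => (ω k).1.2)
    beta_reduce
    rw [e1, e2]
  by_contra hcon
  have hup := cp_upper p q a b ha hb (C.block hN).Φ (D.block hN).Φ
    ((C.block hN).hΦ haU) ((D.block hN).hΦ hbU) d hd0.le ?_ ?_
  · have := (dimH_mono hXr).trans hup
    rw [hδX, ENNReal.ofReal_le_ofReal_iff hd0.le] at this
    linarith
  · intro m u hm hab
    by_contra hlt
    push Not at hlt
    apply hcon
    letI : MeasurableSpace {w : Fin m → Fin N → A // cpTyp w = cpTyp u} := ⊤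
    haveI : Nonempty {w : Fin m → Fin N → A // cpTyp w = cpTyp u} := ⟨⟨u, rfl⟩⟩
    obtain ⟨K, hK, hb⟩ := cp_tball_gen p q hinj (C.block hN) (D.block hN) a b ha hb hκ haU haL hbU hbL
      hm u hab
    refine ⟨_, ?_, cp_erg F G C D hC hD A hN hm {w : Fin m → Fin N → A // cpTyp w = cpTyp u}
      Subtype.val _ K hK hb⟩
    refine hκs _ ?_
    convert hlt.le
  · intro m u hm hab
    by_contra hlt
    push Not at hlt
    apply hcon
    letI : MeasurableSpace {w : Fin m → Fin N → A // cpTyp w = cpTyp u} := ⊤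
    haveI : Nonempty {w : Fin m → Fin N → A // cpTyp w = cpTyp u} := ⟨⟨u, rfl⟩⟩
    obtain ⟨K, hK, hb⟩ := cp_tball_gen q p hinj' (D.block hN) (C.block hN) b a hb ha hκ hbU hbL haU haL
      hm u hab
    refine ⟨_, ?_, cp_erg F G C D hC hD A hN hm {w : Fin m → Fin N → A // cpTyp w = cpTyp u}
      Subtype.val _ K hK fun L hL x y => (measure_mono ?_).trans (hb L hL y x)⟩
    · refine hκs _ ?_
      convert hlt.le
    · intro ω hω
      exact ⟨hω.2, hω.1⟩


/-- Variational principle: the Hausdorff dimension of a non-linear carpet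
satisfying the coordinate open set condition is the supremum of the Hausdorff dimensions of
ergodic measures on it. -/
theorem stmt0 {Λ₁ Λ₂ : Type} [Fintype Λ₁] [Fintype Λ₂] [Nonempty Λ₁] [Nonempty Λ₂]
    (F : ConformalIFS Λ₁) (G : ConformalIFS Λ₂)
    (A : Set (Λ₁ × Λ₂)) (hA : A.Nonempty)
    (hF : CoordOSC F) (hG : CoordOSC G)
    (X : Set (ℝ × ℝ)) (hX : IsCarpetAttractor F G A X) :
    (∀ μ : MeasureTheory.Measure (ℝ × ℝ), IsErgodicCarpetMeasure F G A μ →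
      dimHMeasure μ ≤ dimH X) ∧
    (∀ ε : ℝ, 0 < ε → ∃ μ : MeasureTheory.Measure (ℝ × ℝ),
      IsErgodicCarpetMeasure F G A μ ∧ dimH X - ENNReal.ofReal ε ≤ dimHMeasure μ) := by
  obtain ⟨C, hCF, hC⟩ := cs_base F hF
  obtain ⟨D, hDG, hD⟩ := cs_base G hG
  exact ⟨fun μ hμ => cp_first F G C D hCF hDG hC hD A X hX μ hμ,
    fun ε hε => cp_second F G C D hCF hDG hC hD A hA X hX ε hε⟩

end
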